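/- Let r > 0, θ ∈ ℝ, σ > 0, and let h : ℝ → ℝ be bounded and measurable. Let f_h be the solution of the VG(r,θ,σ,0) Stein equation with test function h. Then for every x ≠ 0, |x·f_h(x)| ≤ (1 + 6/r + B(r,θ,σ)) · sup_{t∈ℝ} |h̃(t)|. -/

import Mathlib

open MeasureTheory Real Filter

/-- Modified Bessel function of the second kind. -/
noncomputable def besselK (ν x : ℝ) : ℝ :=
  ∫ t in Set.Ioi (0:ℝ), Real.exp (-x * Real.cosh t) * Real.cosh (ν * t)

/-- Modified Bessel function of the first kind. -/
noncomputable def besselI (ν x : ℝ) : ℝ :=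
  ∑' k : ℕ, (x / 2) ^ (ν + 2 * (k : ℝ)) / (Real.Gamma (ν + (k : ℝ) + 1) * (Nat.factorial k))

/-- The VG(r,θ,σ,0) density. -/
noncomputable def vgDensity (r θ σ x : ℝ) : ℝ :=
  (σ * Real.sqrt Real.pi * Real.Gamma (r / 2))⁻¹ * Real.exp (θ * x / σ ^ 2) *
    (|x| / (2 * Real.sqrt (θ ^ 2 + σ ^ 2))) ^ ((r - 1) / 2) *
    besselK ((r - 1) / 2) (Real.sqrt (θ ^ 2 + σ ^ 2) * |x| / σ ^ 2)

/-- The centred test function h̃(x) = h(x) − E h(Z). -/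
noncomputable def htilde (r θ σ : ℝ) (h : ℝ → ℝ) (x : ℝ) : ℝ :=
  h x - ∫ t, h t * vgDensity r θ σ t

/-- The solution of the VG(r,θ,σ,0) Stein equation with test function h. -/
noncomputable def steinSolution (r θ σ : ℝ) (h : ℝ → ℝ) (x : ℝ) : ℝ :=
  -(Real.exp (-(θ / σ ^ 2) * x) *
      besselK ((r - 1) / 2) (Real.sqrt (θ ^ 2 + σ ^ 2) / σ ^ 2 * |x|) /
      (σ ^ 2 * |x| ^ ((r - 1) / 2))) *
    (∫ t in (0:ℝ)..x, Real.exp ((θ / σ ^ 2) * t) * |t| ^ ((r - 1) / 2) *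
      besselI ((r - 1) / 2) (Real.sqrt (θ ^ 2 + σ ^ 2) / σ ^ 2 * |t|) * htilde r θ σ h t) -
  (Real.exp (-(θ / σ ^ 2) * x) *
      besselI ((r - 1) / 2) (Real.sqrt (θ ^ 2 + σ ^ 2) / σ ^ 2 * |x|) /
      (σ ^ 2 * |x| ^ ((r - 1) / 2))) *
    (∫ t in Set.Ioi x, Real.exp ((θ / σ ^ 2) * t) * |t| ^ ((r - 1) / 2) *
      besselK ((r - 1) / 2) (Real.sqrt (θ ^ 2 + σ ^ 2) / σ ^ 2 * |t|) * htilde r θ σ h t)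

/-- The constant A(r,θ,σ). -/
noncomputable def Aconst (r θ σ : ℝ) : ℝ :=
  if 2 ≤ r then 2 * Real.sqrt Real.pi / Real.sqrt (2 * r - 1) * (1 + θ ^ 2 / σ ^ 2) ^ (r / 2)
  else 12 * Real.Gamma (r / 2) * (1 + θ ^ 2 / σ ^ 2)

/-- The constant B(r,θ,σ). -/
noncomputable def Bconst (r θ σ : ℝ) : ℝ :=
  if 2 ≤ r then Real.sqrt (Real.pi * (r - 1) / 2) * (1 + θ ^ 2 / σ ^ 2) ^ (r / 2 - 1)
  else 2

/-- The constant C(r,θ,σ). -/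
noncomputable def Cconst (r θ σ : ℝ) : ℝ :=
  6 + 2 * Real.sqrt 2 / Real.sqrt r +
    2 * Real.sqrt (2 * Real.pi * (r + 1)) * (|θ| / σ) * (1 + θ ^ 2 / σ ^ 2) ^ ((r - 1) / 2) +
    2 * (Real.sqrt (2 * r) + r) * Aconst r θ σ

/-- Bessel-Clifford type series. -/
noncomputable def bphi (ν z : ℝ) : ℝ := ∑' k : ℕ, z ^ k / (Real.Gamma (ν + (k:ℝ) + 1) * (Nat.factorial k))

lemma bphi_gamma_lower (ν : ℝ) (hν : -1 < ν) : ∃ c : ℝ, 0 < c ∧ ∀ k : ℕ, c ≤ Real.Gamma (ν + (k:ℝ) + 1) := by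
  have h1 : 0 < Real.Gamma (ν + 1) := Real.Gamma_pos_of_pos (by linarith)
  have h2 : 0 < Real.Gamma (ν + 1 + 1) := Real.Gamma_pos_of_pos (by linarith)
  refine ⟨min (Real.Gamma (ν+1)) (Real.Gamma (ν+1+1)), lt_min h1 h2, fun k => ?_⟩
  rcases k with _ | k
  · simp
  · induction k with
    | zero => simp
    | succ k ih =>
      refine ih.trans ?_
      have hpos : 0 < ν + ((k+1:ℕ):ℝ) + 1 := by push_cast; have : (0:ℝ) ≤ k := k.cast_nonneg; linarith
      have : ν + ((k+1+1:ℕ):ℝ) + 1 = (ν + ((k+1:ℕ):ℝ) + 1) + 1 := by push_cast; ring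
      rw [this, Real.Gamma_add_one hpos.ne']
      have h3 := Real.Gamma_pos_of_pos hpos
      have h4 : 1 ≤ ν + ((k+1:ℕ):ℝ) + 1 := by push_cast; have : (0:ℝ) ≤ k := k.cast_nonneg; linarith
      nlinarith

lemma bphi_summable (ν : ℝ) (hν : -1 < ν) (z : ℝ) :
    Summable (fun k : ℕ => z ^ k / (Real.Gamma (ν + (k:ℝ) + 1) * (Nat.factorial k))) := by
  obtain ⟨c, hc, h⟩ := bphi_gamma_lower ν hν
  refine Summable.of_norm_bounded (g := fun k : ℕ => c⁻¹ * (|z| ^ k / (Nat.factorial k)))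
    ((Real.summable_pow_div_factorial |z|).mul_left _) (fun k => ?_)
  have hf : (0:ℝ) < Nat.factorial k := by exact_mod_cast Nat.factorial_pos k
  have hg := hc.trans_le (h k)
  rw [Real.norm_eq_abs, abs_div, abs_pow, abs_of_pos (mul_pos hg hf), inv_mul_eq_div, div_div, mul_comm (Nat.factorial k : ℝ) c]
  gcongr
  exact h k

lemma bphi_hasDerivAt (ν : ℝ) (hν : -1 < ν) (z : ℝ) : HasDerivAt (bphi ν) (bphi (ν+1) z) z := by
  have hshift : ∀ w : ℝ, ∀ k : ℕ, ((k+1 : ℕ) : ℝ) * w ^ (k+1-1) / (Real.Gamma (ν + ((k+1:ℕ):ℝ) + 1) * (Nat.factorial (k+1)))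
      = w ^ k / (Real.Gamma (ν + 1 + (k:ℝ) + 1) * (Nat.factorial k)) := by
    intro w k
    have h1 : ν + ((k+1:ℕ):ℝ) + 1 = ν + 1 + (k:ℝ) + 1 := by push_cast; ring
    have hf : (0:ℝ) < Nat.factorial k := by exact_mod_cast Nat.factorial_pos k
    have hg : 0 < Real.Gamma (ν + 1 + (k:ℝ) + 1) := Real.Gamma_pos_of_pos (by
      have : (0:ℝ) ≤ k := k.cast_nonneg
      linarith)
    rw [h1, Nat.factorial_succ]
    simp only [Nat.add_sub_cancel]
    push_cast
    have : (k:ℝ) + 1 ≠ 0 := by positivity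
    field_simp
  have hs : ∀ w : ℝ, Summable (fun k : ℕ => (k:ℝ) * w ^ (k-1) / (Real.Gamma (ν + (k:ℝ) + 1) * (Nat.factorial k))) := by
    intro w
    rw [← summable_nat_add_iff 1]
    simp_rw [hshift w]
    exact bphi_summable (ν+1) (by linarith) w
  set R := |z| + 1
  have key := hasDerivAt_tsum_of_isPreconnected (𝕜 := ℝ) (F := ℝ) (t := Metric.ball (0:ℝ) R) (y₀ := 0) (y := z)
    (g := fun (k : ℕ) (w : ℝ) => w ^ k / (Real.Gamma (ν + (k:ℝ) + 1) * (Nat.factorial k)))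
    (g' := fun (k : ℕ) (w : ℝ) => (k:ℝ) * w ^ (k-1) / (Real.Gamma (ν + (k:ℝ) + 1) * (Nat.factorial k)))
    (hs R) Metric.isOpen_ball (convex_ball (0:ℝ) R).isPreconnected
    (fun n y _ => (hasDerivAt_pow n y).div_const _) (fun n y hy => by
      have hf : (0:ℝ) < Nat.factorial n := by exact_mod_cast Nat.factorial_pos n
      have hg : 0 < Real.Gamma (ν + (n:ℝ) + 1) := Real.Gamma_pos_of_pos (by
        have : (0:ℝ) ≤ n := n.cast_nonneg
        linarith)
      rw [Real.norm_eq_abs, abs_div, abs_mul, abs_pow, abs_of_pos (mul_pos hg hf), Nat.abs_cast]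
      have : |y| ≤ R := by simpa using (le_of_lt (by simpa using hy) : |y| ≤ R)
      gcongr) (by simp [R]; positivity) (bphi_summable ν hν 0) (by simp [R])
  have e : (∑' k : ℕ, (k:ℝ) * z ^ (k-1) / (Real.Gamma (ν + (k:ℝ) + 1) * (Nat.factorial k))) = bphi (ν+1) z := by
    rw [(hs z).tsum_eq_zero_add]
    simp_rw [hshift z]
    simp [bphi]
  rw [e] at key
  exact key

lemma bphi_rec (ν : ℝ) (hν : -1 < ν) (z : ℝ) : bphi ν z = (ν+1) * bphi (ν+1) z + z * bphi (ν+2) z := by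
  have h1 := bphi_summable ν hν z
  have h2 := bphi_summable (ν+1) (by linarith) z
  have h3 := bphi_summable (ν+2) (by linarith) z
  have hg : ∀ k : ℕ, 0 < ν + 1 + (k:ℝ) := fun k => by
    have : (0:ℝ) ≤ k := k.cast_nonneg
    linarith
  have hs : Summable (fun k : ℕ => (k:ℝ) * (z ^ k / (Real.Gamma (ν + 1 + (k:ℝ) + 1) * (Nat.factorial k)))) ∧
      ∑' k : ℕ, (k:ℝ) * (z ^ k / (Real.Gamma (ν + 1 + (k:ℝ) + 1) * (Nat.factorial k))) = z * bphi (ν+2) z := by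
    have e : ∀ k : ℕ, ((k+1:ℕ):ℝ) * (z ^ (k+1) / (Real.Gamma (ν + 1 + ((k+1:ℕ):ℝ) + 1) * (Nat.factorial (k+1))))
        = z * (z ^ k / (Real.Gamma (ν + 2 + (k:ℝ) + 1) * (Nat.factorial k))) := by
      intro k
      have h1 : ν + 1 + ((k+1:ℕ):ℝ) + 1 = ν + 2 + (k:ℝ) + 1 := by push_cast; ring
      have hf : (0:ℝ) < Nat.factorial k := by exact_mod_cast Nat.factorial_pos k
      have hg : 0 < Real.Gamma (ν + 2 + (k:ℝ) + 1) := Real.Gamma_pos_of_pos (by linarith [hg k])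
      rw [h1, Nat.factorial_succ]
      push_cast
      have : (k:ℝ) + 1 ≠ 0 := by positivity
      field_simp
      ring
    have hS : Summable (fun k : ℕ => (k:ℝ) * (z ^ k / (Real.Gamma (ν + 1 + (k:ℝ) + 1) * (Nat.factorial k)))) := by
      rw [← summable_nat_add_iff 1]
      simp_rw [e]
      exact h3.mul_left z
    refine ⟨hS, ?_⟩
    rw [hS.tsum_eq_zero_add]
    simp_rw [e]
    rw [tsum_mul_left]
    simp [bphi]
  rw [← hs.2]
  unfold bphi
  rw [← tsum_mul_left, ← (h2.mul_left _).tsum_add hs.1]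
  refine tsum_congr (fun k => ?_)
  have hf : (0:ℝ) < Nat.factorial k := by exact_mod_cast Nat.factorial_pos k
  have h5 : 0 < Real.Gamma (ν + 1 + (k:ℝ)) := Real.Gamma_pos_of_pos (hg k)
  rw [Real.Gamma_add_one (hg k).ne', show ν + (k:ℝ) + 1 = ν + 1 + k by ring]
  have := (hg k).ne'
  field_simp

lemma bphi_pos (ν : ℝ) (hν : -1 < ν) (z : ℝ) (hz : 0 ≤ z) : 0 < bphi ν z := by
  have hg : ∀ k : ℕ, 0 < Real.Gamma (ν + (k:ℝ) + 1) := fun k => Real.Gamma_pos_of_pos (by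
    have : (0:ℝ) ≤ k := k.cast_nonneg
    linarith)
  refine (bphi_summable ν hν z).tsum_pos (fun k => ?_) 0 ?_
  · have := hg k
    positivity
  · have := hg 0
    simp only [pow_zero]
    positivity

lemma bphi_zero (ν : ℝ) : bphi ν 0 = (Real.Gamma (ν+1))⁻¹ := by
  unfold bphi
  rw [tsum_eq_single 0]
  · simp
  · intro k hk
    simp [hk]

lemma besselI_eq (ν x : ℝ) (hx : 0 < x) : besselI ν x = (x/2)^ν * bphi ν (x^2/4) := by
  unfold besselI bphi
  rw [← tsum_mul_left]
  refine tsum_congr (fun k => ?_)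
  have : (0:ℝ) < x/2 := by positivity
  rw [Real.rpow_add this, show (2 * (k:ℝ)) = ((2*k : ℕ):ℝ) by push_cast; ring, Real.rpow_natCast, pow_mul,
    show (x/2)^2 = x^2/4 by ring, mul_div_assoc]

/-- `G` -/
noncomputable def GI (ν x : ℝ) : ℝ := bphi ν (x^2/4)
/-- `H` -/
noncomputable def HI (ν x : ℝ) : ℝ := x/2 * bphi (ν+1) (x^2/4)

lemma GI_pos (ν : ℝ) (hν : -1 < ν) (x : ℝ) : 0 < GI ν x := bphi_pos ν hν _ (by positivity)
lemma HI_nonneg (ν : ℝ) (hν : -1 < ν) (x : ℝ) (hx : 0 ≤ x) : 0 ≤ HI ν x :=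
  mul_nonneg (by positivity) (bphi_pos (ν+1) (by linarith) _ (by positivity)).le

lemma GI_hasDerivAt (ν : ℝ) (hν : -1 < ν) (x : ℝ) : HasDerivAt (GI ν) (HI ν x) x := by
  have h1 : HasDerivAt (fun x : ℝ => x^2/4) (x/2) x := by
    have := (hasDerivAt_pow 2 x).div_const 4
    refine this.congr_deriv ?_
    simp; ring
  have := (bphi_hasDerivAt ν hν (x^2/4)).comp x h1
  refine this.congr_deriv ?_
  unfold HI; ring

lemma HI_hasDerivAt' (ν : ℝ) (hν : -1 < ν) (x : ℝ) :
    HasDerivAt (HI ν) (GI ν x - (ν + 1/2) * bphi (ν+1) (x^2/4)) x := by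
  have h1 := ((hasDerivAt_id x).div_const 2).mul (GI_hasDerivAt (ν+1) (by linarith) x)
  refine h1.congr_deriv ?_
  unfold GI HI
  rw [bphi_rec ν hν, show ν + 1 + 1 = ν + 2 by ring]
  simp
  ring

lemma HI_hasDerivAt (ν : ℝ) (hν : -1 < ν) (x : ℝ) (hx : 0 < x) :
    HasDerivAt (HI ν) (GI ν x - (2 * ν + 1) * HI ν x / x) x := by
  refine (HI_hasDerivAt' ν hν x).congr_deriv ?_
  unfold HI
  field_simp

lemma GI_continuous (ν : ℝ) (hν : -1 < ν) : Continuous (GI ν) :=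
  continuous_iff_continuousAt.2 fun x => (GI_hasDerivAt ν hν x).continuousAt
lemma HI_continuous (ν : ℝ) (hν : -1 < ν) : Continuous (HI ν) :=
  continuous_iff_continuousAt.2 fun x => (HI_hasDerivAt' ν hν x).continuousAt

lemma HI_le_GI (ν : ℝ) (hν : -1/2 ≤ ν) (x : ℝ) (hx : 0 ≤ x) : HI ν x ≤ GI ν x := by
  have hν' : -1 < ν := by linarith
  have hd : ∀ y, HasDerivAt (fun y => Real.exp y * (GI ν y - HI ν y))
      (Real.exp y * ((ν + 1/2) * bphi (ν+1) (y^2/4))) y := by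
    intro y
    have := (Real.hasDerivAt_exp y).mul ((GI_hasDerivAt ν hν' y).sub (HI_hasDerivAt' ν hν' y))
    refine this.congr_deriv ?_
    simp; ring
  have hm : MonotoneOn (fun y => Real.exp y * (GI ν y - HI ν y)) (Set.Ici 0) := by
    refine monotoneOn_of_deriv_nonneg (convex_Ici 0) (fun y _ => (hd y).continuousAt.continuousWithinAt)
      (fun y _ => (hd y).differentiableAt.differentiableWithinAt) (fun y hy => ?_)
    rw [(hd y).deriv]
    rw [interior_Ici] at hy
    have h1 := HI_nonneg ν hν' y (le_of_lt hy)
    have h2 := bphi_pos (ν+1) (by linarith) (y^2/4) (by positivity)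
    have h3 : 0 ≤ ν + 1/2 := by linarith
    positivity
  have := hm (Set.mem_Ici.2 le_rfl) (Set.mem_Ici.2 hx) hx
  have h0 : HI ν 0 = 0 := by simp [HI]
  simp only [h0, Real.exp_zero] at this
  have h2 := GI_pos ν hν' 0
  have h3 : 0 < Real.exp x * (GI ν x - HI ν x) := by linarith
  have := (pos_iff_pos_of_mul_pos h3).1 (Real.exp_pos x)
  linarith

lemma GI_HI_lower (ν : ℝ) (hν : 1/2 ≤ ν) (x : ℝ) (hx : 0 ≤ x) :
    x * GI ν x ≤ x * HI ν x + (ν + 1/2) * GI ν x := by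
  have hν' : -1 < ν := by linarith
  have hd : ∀ y, 0 < y → HasDerivAt (fun y => Real.exp y * (y * HI ν y - y * GI ν y + (ν+1/2) * GI ν y))
      (Real.exp y * ((ν - 1/2) * (GI ν y - HI ν y))) y := by
    intro y hy
    have := (Real.hasDerivAt_exp y).mul ((((hasDerivAt_id y).mul (HI_hasDerivAt ν hν' y hy)).sub
      ((hasDerivAt_id y).mul (GI_hasDerivAt ν hν' y))).add ((GI_hasDerivAt ν hν' y).const_mul (ν+1/2)))
    refine this.congr_deriv ?_
    simp
    field_simp
    ring
  have hm : MonotoneOn (fun y => Real.exp y * (y * HI ν y - y * GI ν y + (ν+1/2) * GI ν y)) (Set.Ici 0) := by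
    have c1 := GI_continuous ν hν'
    have c2 := HI_continuous ν hν'
    refine monotoneOn_of_deriv_nonneg (convex_Ici 0) (by fun_prop)
      (fun y hy => (hd y (by simpa using hy)).differentiableAt.differentiableWithinAt) (fun y hy => ?_)
    rw [interior_Ici] at hy
    rw [(hd y hy).deriv]
    have h1 := HI_le_GI ν (by linarith) y (le_of_lt hy)
    have h3 : 0 ≤ ν - 1/2 := by linarith
    have h4 : 0 ≤ GI ν y - HI ν y := by linarith
    positivity
  have := hm (Set.mem_Ici.2 le_rfl) (Set.mem_Ici.2 hx) hx
  simp only [zero_mul, Real.exp_zero] at this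
  have h2 := GI_pos ν hν' 0
  have h3 : 0 < Real.exp x * (x * HI ν x - x * GI ν x + (ν+1/2) * GI ν x) := by
    have : 0 < (ν + 1/2) * GI ν 0 := mul_pos (by linarith) h2
    linarith
  have := (pos_iff_pos_of_mul_pos h3).1 (Real.exp_pos x)
  linarith

lemma besselI_eq_GI (ν x : ℝ) (hx : 0 < x) : besselI ν x = (x/2)^ν * GI ν x := besselI_eq ν x hx
lemma besselI_eq_HI (ν x : ℝ) (hx : 0 < x) : besselI (ν+1) x = (x/2)^ν * HI ν x := by
  rw [besselI_eq _ x hx, Real.rpow_add (by positivity)]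
  simp [HI]; ring

/-- lower integral, `r ≥ 2` -/
lemma lower_int_large (r b x : ℝ) (hr : 2 ≤ r) (hx : 0 < x)
    (hinteg : IntervalIntegrable (fun t => Real.exp (b*t) * t^(r-1) * GI ((r-1)/2) t) volume 0 x) (hb : -1 < b) :
    ∫ t in (0:ℝ)..x, Real.exp (b*t) * t^(r-1) * GI ((r-1)/2) t ≤ (1+b)⁻¹ * (Real.exp (b*x) * x^(r-1) * GI ((r-1)/2) x) := by
  set ν := (r-1)/2 with hν
  have hν' : -1 < ν := by linarith
  have c1 := GI_continuous ν hν'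
  have hb' : 0 < 1 + b := by linarith
  have key := intervalIntegral.integral_le_sub_of_hasDeriv_right_of_le (a := 0) (b := x)
    (g := fun t => (1+b)⁻¹ * (Real.exp (b*t) * t^(r-1) * GI ν t))
    (g' := fun t => (1+b)⁻¹ * ((Real.exp (b*t) * b * t^(r-1) + Real.exp (b*t) * ((r-1) * t^(r-1-1))) * GI ν t
      + Real.exp (b*t) * t^(r-1) * HI ν t))
    (φ := fun t => Real.exp (b*t) * t^(r-1) * GI ν t) hx.le
    (by
      have : Continuous fun t : ℝ => t^(r-1) := Real.continuous_rpow_const (by linarith)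
      fun_prop)
    (by
      intro t ht
      refine HasDerivAt.hasDerivWithinAt ?_
      have h1 : HasDerivAt (fun t : ℝ => Real.exp (b*t)) (Real.exp (b*t) * b) t := by
        simpa using ((hasDerivAt_id t).const_mul b).exp
      have h2 : HasDerivAt (fun t : ℝ => t^(r-1)) ((r-1) * t^(r-1-1)) t :=
        Real.hasDerivAt_rpow_const (Or.inl ht.1.ne')
      exact ((h1.mul h2).mul (GI_hasDerivAt ν hν' t)).const_mul _)
    (by rwa [← intervalIntegrable_iff_integrableOn_Icc_of_le hx.le])
    (by
      intro t ht
      have ht0 := ht.1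
      have h1 := GI_HI_lower ν (by linarith) t ht0.le
      have h2 := GI_pos ν hν' t
      rw [le_inv_mul_iff₀ hb', Real.rpow_sub_one ht0.ne' (r-1)]
      have h3 : 0 < Real.exp (b*t) * t^(r-1) := mul_pos (Real.exp_pos _) (Real.rpow_pos_of_pos ht0 _)
      have h4 : GI ν t ≤ (r-1)/t * GI ν t + HI ν t := by
        have : t * GI ν t ≤ (r-1) * GI ν t + t * HI ν t := by
          have : (ν + 1/2) ≤ r - 1 := by rw [hν]; linarith
          nlinarith
        have e : (r-1)/t * GI ν t + HI ν t = ((r-1) * GI ν t + t * HI ν t)/t := by field_simp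
        rw [e, le_div_iff₀ ht0]
        linarith
      calc (1+b) * (Real.exp (b*t) * t^(r-1) * GI ν t)
          = Real.exp (b*t) * t^(r-1) * (b * GI ν t) + Real.exp (b*t) * t^(r-1) * GI ν t := by ring
        _ ≤ Real.exp (b*t) * t^(r-1) * (b * GI ν t) + Real.exp (b*t) * t^(r-1) * ((r-1)/t * GI ν t + HI ν t) := by
            gcongr
        _ = _ := by ring)
  refine key.trans ?_
  simp only [sub_le_self_iff]
  have h2 := GI_pos ν hν' 0
  have : 0 ≤ (0:ℝ)^(r-1) := Real.rpow_nonneg le_rfl _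
  positivity

/-- lower integral, `r ≤ 2` -/
lemma lower_int_small (r b x : ℝ) (hr0 : 0 < r) (hr : r ≤ 2) (hx : 0 < x)
    (hinteg : IntervalIntegrable (fun t => Real.exp (b*t) * t^(r-1) * GI ((r-1)/2) t) volume 0 x) (hb : -1 < b) :
    ∫ t in (0:ℝ)..x, Real.exp (b*t) * t^(r-1) * GI ((r-1)/2) t ≤
      (1+b)⁻¹ * (2/r) * (Real.exp (b*x) * x^(r-1) * (GI ((r-1)/2) x + HI ((r-1)/2) x)) := by
  set ν := (r-1)/2 with hν
  have hν' : -1 < ν := by linarith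
  have c1 := GI_continuous ν hν'
  have c2 := HI_continuous ν hν'
  set ε := 1 + b with hε
  have hb' : 0 < ε := by linarith
  have key := intervalIntegral.integral_le_sub_of_hasDeriv_right_of_le (a := 0) (b := x)
    (g := fun t => (2/r) * (Real.exp (b*t) * t^r * (GI ν t + HI ν t) / (1 + ε * t)))
    (g' := fun t => (2/r) * ((((Real.exp (b*t) * b * t^r + Real.exp (b*t) * (r * t^(r-1))) * (GI ν t + HI ν t)
      + Real.exp (b*t) * t^r * (HI ν t + (GI ν t - (2 * ν + 1) * HI ν t / t))) * (1+ε*t)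
        - Real.exp (b*t) * t^r * (GI ν t + HI ν t) * ε) / (1+ε*t)^2))
    (φ := fun t => Real.exp (b*t) * t^(r-1) * GI ν t) hx.le
    (by
      have : Continuous fun t : ℝ => t^r := Real.continuous_rpow_const (by linarith)
      refine ContinuousOn.mul continuousOn_const (ContinuousOn.div (by fun_prop) (by fun_prop) ?_)
      intro t ht
      have := mul_nonneg hb'.le ht.1
      positivity)
    (by
      intro t ht
      refine HasDerivAt.hasDerivWithinAt ?_
      have h1 : HasDerivAt (fun t : ℝ => Real.exp (b*t)) (Real.exp (b*t) * b) t := by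
        simpa using ((hasDerivAt_id t).const_mul b).exp
      have h2 : HasDerivAt (fun t : ℝ => t^r) (r * t^(r-1)) t :=
        Real.hasDerivAt_rpow_const (Or.inl ht.1.ne')
      have h3 : HasDerivAt (fun t : ℝ => 1 + ε * t) ε t := by
        simpa using ((hasDerivAt_id t).const_mul ε).const_add 1
      have := mul_pos hb' ht.1
      exact (((h1.mul h2).mul ((GI_hasDerivAt ν hν' t).add (HI_hasDerivAt ν hν' t ht.1))).div h3 (by positivity)).const_mul _)
    (by rwa [← intervalIntegrable_iff_integrableOn_Icc_of_le hx.le])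
    (by
      intro t ht
      have ht0 := ht.1
      have h2 := GI_pos ν hν' t
      have h5 := HI_nonneg ν hν' t ht0.le
      have h6 : 0 < t^(r-1) := Real.rpow_pos_of_pos ht0 _
      have h7 : t^r = t * t^(r-1) := by
        rw [Real.rpow_sub_one ht0.ne']; field_simp
      have h8 := Real.exp_pos (b*t)
      set s := ε * t with hs
      have hs0 : 0 < s := mul_pos hb' ht0
      have e : (2/r) * ((((Real.exp (b*t) * b * t^r + Real.exp (b*t) * (r * t^(r-1))) * (GI ν t + HI ν t)
      + Real.exp (b*t) * t^r * (HI ν t + (GI ν t - (2 * ν + 1) * HI ν t / t))) * (1+s)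
        - Real.exp (b*t) * t^r * (GI ν t + HI ν t) * ε) / (1+s)^2)
        = Real.exp (b*t) * t^(r-1) * ((2/r) * (((r*(1+s) + s^2) * GI ν t + s^2 * HI ν t) / (1+s)^2)) := by
        rw [h7, hs, hε, hν]
        field_simp
        ring
      rw [e]
      refine mul_le_mul_of_nonneg_left ?_ (by positivity)
      rw [div_mul_div_comm, le_div_iff₀ (by positivity)]
      have : r * (1+s)^2 ≤ 2 * (r*(1+s) + s^2) := by nlinarith [sq_nonneg s]
      nlinarith [mul_le_mul_of_nonneg_right this h2.le, mul_nonneg (sq_nonneg s) h5])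
  refine key.trans ?_
  simp only [Real.zero_rpow hr0.ne', mul_zero, zero_mul, zero_div, sub_zero]
  have h2 := GI_pos ν hν' x
  have h5 := HI_nonneg ν hν' x hx.le
  have h6 : 0 < x^(r-1) := Real.rpow_pos_of_pos hx _
  have h7 : x^r = x * x^(r-1) := by
    rw [Real.rpow_sub_one hx.ne']; field_simp
  have h8 := Real.exp_pos (b*x)
  rw [h7]
  have hs0 : 0 < ε * x := mul_pos hb' hx
  have : x / (1 + ε * x) ≤ ε⁻¹ := by
    rw [div_le_iff₀ (by positivity)]
    field_simp
    linarith
  calc _ = (x / (1 + ε * x)) * (2/r) * (Real.exp (b*x) * x^(r-1) * (GI ν x + HI ν x)) := by ring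
    _ ≤ _ := by gcongr

lemma lower_integrable (r b x : ℝ) (hr : 0 < r) :
    IntervalIntegrable (fun t => Real.exp (b*t) * t^(r-1) * GI ((r-1)/2) t) volume 0 x := by
  have c1 := GI_continuous ((r-1)/2) (by linarith)
  have : IntervalIntegrable (fun t : ℝ => t^(r-1)) volume 0 x := intervalIntegral.intervalIntegrable_rpow' (by linarith)
  have h := this.continuousOn_mul (f := fun t : ℝ => t^(r-1)) (g := fun t => Real.exp (b*t) * GI ((r-1)/2) t) (by fun_prop)
  convert h using 2
  ring

/-- mixing integral -/
noncomputable def kmix (ν z : ℝ) : ℝ := ∫ s in Set.Ioi (0:ℝ), s^(ν-1) * Real.exp (-s - z/s)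

lemma kmix_integrable_pos (ν z : ℝ) (hν : 0 < ν) (hz : 0 ≤ z) :
    IntegrableOn (fun s : ℝ => s^(ν-1) * Real.exp (-s - z/s)) (Set.Ioi 0) := by
  refine Integrable.mono' (Real.GammaIntegral_convergent hν) ?_ ?_
  · exact (by fun_prop : Measurable fun s : ℝ => s^(ν-1) * Real.exp (-s - z/s)).aestronglyMeasurable
  · filter_upwards [ae_restrict_mem measurableSet_Ioi] with s hs
    have hs : 0 < s := hs
    have h1 := Real.rpow_pos_of_pos hs (ν-1)
    rw [Real.norm_eq_abs, abs_of_pos (by positivity), mul_comm]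
    gcongr
    have : 0 ≤ z/s := by positivity
    linarith

lemma kmix_integrable (ν z : ℝ) (hz : 0 < z) :
    IntegrableOn (fun s : ℝ => s^(ν-1) * Real.exp (-s - z/s)) (Set.Ioi 0) := by
  obtain ⟨n, hn⟩ := exists_nat_gt (-ν)
  have h1 := (Real.GammaIntegral_convergent (s := ν + n) (by linarith)).const_mul (n.factorial / z^n)
  refine Integrable.mono' h1 ?_ ?_
  · exact (by fun_prop : Measurable fun s : ℝ => s^(ν-1) * Real.exp (-s - z/s)).aestronglyMeasurable
  · filter_upwards [ae_restrict_mem measurableSet_Ioi] with s hs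
    have hs : 0 < s := hs
    have h1 := Real.rpow_pos_of_pos hs (ν-1)
    rw [Real.norm_eq_abs, abs_of_pos (by positivity)]
    have h2 := Real.pow_div_factorial_le_exp (z/s) (by positivity) n
    have hf : (0:ℝ) < Nat.factorial n := by exact_mod_cast Nat.factorial_pos n
    have h3 : Real.exp (-(z/s)) ≤ n.factorial / z^n * s^n := by
      rw [Real.exp_neg, inv_le_comm₀ (Real.exp_pos _) (by positivity)]
      refine le_trans (le_of_eq ?_) h2
      rw [div_pow]; field_simp
    rw [show ν + n - 1 = (ν - 1) + n by ring, Real.rpow_add hs, Real.rpow_natCast, sub_eq_add_neg (-s), Real.exp_add]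
    calc s^(ν-1) * (Real.exp (-s) * Real.exp (-(z/s))) ≤ s^(ν-1) * (Real.exp (-s) * (n.factorial / z^n * s^n)) := by gcongr
      _ = _ := by ring

lemma kmix_hasDerivAt (ν z : ℝ) (hz : 0 < z) : HasDerivAt (kmix ν) (-(kmix (ν-1) z)) z := by
  have key := hasDerivAt_integral_of_dominated_loc_of_deriv_le (𝕜 := ℝ) (μ := volume.restrict (Set.Ioi (0:ℝ)))
    (F := fun w s => s^(ν-1) * Real.exp (-s - w/s)) (F' := fun w s => -(s^(ν-1-1) * Real.exp (-s - w/s)))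
    (x₀ := z) (s := Set.Ioi (z/2)) (bound := fun s => s^(ν-1-1) * Real.exp (-s - (z/2)/s))
    (Ioi_mem_nhds (by linarith))
    (Eventually.of_forall fun w => (by fun_prop : Measurable fun s : ℝ => s^(ν-1) * Real.exp (-s - w/s)).aestronglyMeasurable)
    (kmix_integrable ν z hz)
    (by exact (by fun_prop : Measurable fun s : ℝ => -(s^(ν-1-1) * Real.exp (-s - z/s))).aestronglyMeasurable)
    (by
      filter_upwards [ae_restrict_mem measurableSet_Ioi] with s hs w hw
      have hs : 0 < s := hs
      have hw : z/2 < w := hw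
      have h1 := Real.rpow_pos_of_pos hs (ν-1-1)
      rw [norm_neg, Real.norm_eq_abs, abs_of_pos (by positivity)]
      gcongr)
    (kmix_integrable (ν-1) (z/2) (by positivity))
    (by
      filter_upwards [ae_restrict_mem measurableSet_Ioi] with s hs w hw
      have hs : 0 < s := hs
      have h1 : HasDerivAt (fun w : ℝ => -s - w/s) (-(1/s)) w := by
        simpa using ((hasDerivAt_id w).div_const s).const_sub (-s)
      refine (h1.exp.const_mul (s^(ν-1))).congr_deriv ?_
      rw [Real.rpow_sub_one hs.ne' (ν-1)]
      ring)
  refine key.2.congr_deriv ?_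
  rw [integral_neg]; rfl

lemma kmix_tendsto (ν : ℝ) (hν : 0 < ν) : Tendsto (kmix ν) (nhdsWithin 0 (Set.Ioi 0)) (nhds (Real.Gamma ν)) := by
  have e : Real.Gamma ν = ∫ s in Set.Ioi (0:ℝ), s^(ν-1) * Real.exp (-s - 0/s) := by
    rw [Real.Gamma_eq_integral hν]
    congr 1; ext s; simp [mul_comm]
  rw [e]
  refine tendsto_integral_filter_of_dominated_convergence (fun s => s^(ν-1) * Real.exp (-s - 0/s)) ?_ ?_ 
    (kmix_integrable_pos ν 0 hν le_rfl) ?_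
  · exact Eventually.of_forall fun w => (by fun_prop : Measurable fun s : ℝ => s^(ν-1) * Real.exp (-s - w/s)).aestronglyMeasurable
  · filter_upwards [self_mem_nhdsWithin] with w hw
    filter_upwards [ae_restrict_mem measurableSet_Ioi] with s hs
    have hs : 0 < s := hs
    have hw : 0 < w := hw
    have h1 := Real.rpow_pos_of_pos hs (ν-1)
    rw [Real.norm_eq_abs, abs_of_pos (by positivity)]
    gcongr
  · refine Eventually.of_forall fun s => ?_
    have : Continuous fun w : ℝ => s^(ν-1) * Real.exp (-s - w/s) := by fun_prop
    exact (this.tendsto 0).mono_left nhdsWithin_le_nhds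

lemma kmix_subst_aux (ν x t : ℝ) (hx : 0 < x) :
    |x/2 * Real.exp t| • ((x/2 * Real.exp t)^(ν-1) * Real.exp (-(x/2 * Real.exp t) - (x^2/4)/(x/2 * Real.exp t)))
     = (x/2)^ν * Real.exp (-x * Real.cosh t + ν * t) := by
  have h0 : 0 < x/2 * Real.exp t := by positivity
  rw [abs_of_pos h0, Real.rpow_sub_one h0.ne', smul_eq_mul, Real.mul_rpow (by positivity) (Real.exp_pos t).le,
    ← Real.exp_mul, Real.exp_add, Real.cosh_eq, Real.exp_neg t]
  have e : -(x/2 * Real.exp t) - (x^2/4)/(x/2 * Real.exp t) = -x * ((Real.exp t + (Real.exp t)⁻¹)/2) := by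
    field_simp
    ring
  rw [e]
  field_simp

lemma image_exp (x : ℝ) (hx : 0 < x) : (fun t => x/2 * Real.exp t) '' Set.univ = Set.Ioi 0 := by
  ext s
  simp only [Set.image_univ, Set.mem_range, Set.mem_Ioi]
  constructor
  · rintro ⟨t, rfl⟩; positivity
  · intro hs
    exact ⟨Real.log (s / (x/2)), by rw [Real.exp_log (by positivity)]; field_simp⟩

lemma kexp_integrable (ν x : ℝ) (hx : 0 < x) : Integrable (fun t => Real.exp (-x * Real.cosh t + ν * t)) := by
  have h := kmix_integrable ν (x^2/4) (by positivity)
  rw [← image_exp x hx, integrableOn_image_iff_integrableOn_abs_deriv_smul MeasurableSet.univ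
    (f' := fun t => x/2 * Real.exp t) (fun t _ => ((Real.hasDerivAt_exp t).const_mul (x/2)).hasDerivWithinAt)
    (fun a _ b _ hab => by
      have : x/2 * Real.exp a = x/2 * Real.exp b := hab
      exact Real.exp_injective (mul_left_cancel₀ (by positivity) this))] at h
  simp_rw [kmix_subst_aux ν x _ hx] at h
  rw [integrableOn_univ] at h
  have := h.const_mul ((x/2)^ν)⁻¹
  refine this.congr (Eventually.of_forall fun t => ?_)
  have : 0 < (x/2)^ν := by positivity
  simp only
  field_simp

lemma kmix_eq_kexp (ν x : ℝ) (hx : 0 < x) :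
    kmix ν (x^2/4) = (x/2)^ν * ∫ t, Real.exp (-x * Real.cosh t + ν * t) := by
  unfold kmix
  rw [← image_exp x hx, integral_image_eq_integral_abs_deriv_smul MeasurableSet.univ
    (f' := fun t => x/2 * Real.exp t) (fun t _ => ((Real.hasDerivAt_exp t).const_mul (x/2)).hasDerivWithinAt)
    (fun a _ b _ hab => by
      have : x/2 * Real.exp a = x/2 * Real.exp b := hab
      exact Real.exp_injective (mul_left_cancel₀ (by positivity) this))]
  simp_rw [kmix_subst_aux ν x _ hx]
  rw [setIntegral_univ, integral_const_mul]

lemma kcosh_eq (ν x t : ℝ) : Real.exp (-x * Real.cosh t) * Real.cosh (ν * t) =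
    (1/2) * (Real.exp (-x * Real.cosh t + ν * t) + Real.exp (-x * Real.cosh t + (-ν) * t)) := by
  rw [Real.cosh_eq (ν*t), Real.exp_add, Real.exp_add, neg_mul ν t]; ring

lemma kcosh_integrable (ν x : ℝ) (hx : 0 < x) : Integrable (fun t => Real.exp (-x * Real.cosh t) * Real.cosh (ν * t)) := by
  simp_rw [kcosh_eq]
  exact ((kexp_integrable ν x hx).add (kexp_integrable (-ν) x hx)).const_mul _

lemma besselK_eq_kexp (ν x : ℝ) (hx : 0 < x) :
    besselK ν x = (1/2) * ∫ t, Real.exp (-x * Real.cosh t + ν * t) := by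
  have h1 : ∫ t, Real.exp (-x * Real.cosh t) * Real.cosh (ν * t) = 2 * besselK ν x := by
    have := integral_comp_abs (f := fun t => Real.exp (-x * Real.cosh t) * Real.cosh (ν * t))
    unfold besselK
    rw [← this]
    congr 1; ext t
    rw [Real.cosh_abs, ← Real.cosh_abs (ν * |t|), abs_mul, abs_abs, ← abs_mul, Real.cosh_abs]
  have h2 : ∫ t, Real.exp (-x * Real.cosh t + (-ν) * t) = ∫ t, Real.exp (-x * Real.cosh t + ν * t) := by
    rw [← integral_neg_eq_self]
    simp
  simp_rw [kcosh_eq] at h1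
  rw [integral_const_mul, integral_add (kexp_integrable ν x hx) (kexp_integrable (-ν) x hx), h2] at h1
  linarith

lemma besselK_mix (ν x : ℝ) (hx : 0 < x) : x^ν * besselK ν x = 2^(ν-1) * kmix ν (x^2/4) := by
  rw [besselK_eq_kexp ν x hx, kmix_eq_kexp ν x hx, Real.div_rpow hx.le (by norm_num), Real.rpow_sub_one (by norm_num)]
  have : (0:ℝ) < 2^ν := by positivity
  field_simp

lemma besselK_neg (ν x : ℝ) : besselK (-ν) x = besselK ν x := by
  unfold besselK
  simp

lemma besselK_mono (μ ν x : ℝ) (hx : 0 < x) (h : |μ| ≤ |ν|) : besselK μ x ≤ besselK ν x := by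
  refine setIntegral_mono_on (kcosh_integrable μ x hx).integrableOn (kcosh_integrable ν x hx).integrableOn measurableSet_Ioi ?_
  intro t ht
  have : Real.cosh (μ * t) ≤ Real.cosh (ν * t) := by
    rw [Real.cosh_le_cosh, abs_mul, abs_mul]
    gcongr
  gcongr

lemma besselK_nonneg (ν x : ℝ) : 0 ≤ besselK ν x :=
  setIntegral_nonneg measurableSet_Ioi (fun t _ => mul_nonneg (Real.exp_pos _).le (Real.cosh_pos _).le)

lemma besselK_pos (ν x : ℝ) (hx : 0 < x) : 0 < besselK ν x := by
  rw [besselK_eq_kexp ν x hx]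
  have := integral_exp_pos (kexp_integrable ν x hx)
  positivity

lemma besselK_decay (ν x : ℝ) (hx : 1 ≤ x) : besselK ν x ≤ Real.exp (-(x-1)) * besselK ν 1 := by
  unfold besselK
  rw [← integral_const_mul]
  refine setIntegral_mono_on (kcosh_integrable ν x (by linarith)).integrableOn
    ((kcosh_integrable ν 1 one_pos).integrableOn.const_mul _) measurableSet_Ioi ?_
  intro t ht
  rw [← mul_assoc, ← Real.exp_add]
  have := Real.cosh_pos (ν * t)
  gcongr
  nlinarith [Real.one_le_cosh t]

/-- `x^ν K_ν(x)` has derivative `-x^ν K_{ν-1}(x)`. -/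
lemma besselK_hasDerivAt (ν x : ℝ) (hx : 0 < x) :
    HasDerivAt (fun x => x^ν * besselK ν x) (-(x^ν * besselK (ν-1) x)) x := by
  have h1 : HasDerivAt (fun x : ℝ => x^2/4) (x/2) x := by
    have := (hasDerivAt_pow 2 x).div_const 4
    refine this.congr_deriv ?_
    simp; ring
  have h2 := ((kmix_hasDerivAt ν (x^2/4) (by positivity)).comp x h1).const_mul ((2:ℝ)^(ν-1))
  have h3 : HasDerivAt (fun x => x^ν * besselK ν x) (2^(ν-1) * (-kmix (ν-1) (x^2/4) * (x/2))) x := by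
    refine h2.congr_of_eventuallyEq ?_
    filter_upwards [lt_mem_nhds hx] with y hy
    exact besselK_mix ν y hy
  refine h3.congr_deriv ?_
  have h4 := besselK_mix (ν-1) x hx
  rw [Real.rpow_sub_one hx.ne', Real.rpow_sub_one (by norm_num)] at h4
  have : x^ν * besselK (ν-1) x = x * (2^(ν-1)/2 * kmix (ν-1) (x^2/4)) := by
    rw [← h4]; field_simp
  rw [this]; ring

lemma besselK_tendsto_zero (ν : ℝ) (hν : 0 < ν) :
    Tendsto (fun x => x^ν * besselK ν x) (nhdsWithin 0 (Set.Ioi 0)) (nhds (2^(ν-1) * Real.Gamma ν)) := by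
  have h1 : Tendsto (fun x : ℝ => x^2/4) (nhdsWithin 0 (Set.Ioi 0)) (nhdsWithin 0 (Set.Ioi 0)) := by
    refine tendsto_nhdsWithin_iff.2 ⟨?_, ?_⟩
    · have : Continuous fun x : ℝ => x^2/4 := by fun_prop
      have := this.tendsto 0
      simp only [ne_eq, OfNat.ofNat_ne_zero, not_false_eq_true, zero_pow, zero_div] at this
      exact this.mono_left nhdsWithin_le_nhds
    · filter_upwards [self_mem_nhdsWithin] with x hx
      have hx : 0 < x := hx
      exact (by positivity : 0 < x^2/4)
  refine (((kmix_tendsto ν hν).comp h1).const_mul _).congr' ?_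
  filter_upwards [self_mem_nhdsWithin] with x hx
  exact (besselK_mix ν x hx).symm

/-- derivative of `x^ν K_{ν-1}` -/
lemma besselK_hasDerivAt' (ν x : ℝ) (hx : 0 < x) :
    HasDerivAt (fun x => x^ν * besselK (ν-1) x) ((2*ν-1) * (x^ν * besselK (ν-1) x) / x - x^ν * besselK ν x) x := by
  have h1 := (besselK_hasDerivAt (1-ν) x hx)
  have h2 : HasDerivAt (fun x : ℝ => x^(2*ν-1)) ((2*ν-1) * x^(2*ν-1-1)) x := Real.hasDerivAt_rpow_const (Or.inl hx.ne')
  have e : ∀ y, besselK (1-ν) y = besselK (ν-1) y := fun y => by rw [← besselK_neg]; congr 1; ring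
  have e' : besselK (1-ν-1) x = besselK ν x := by rw [← besselK_neg]; congr 1; ring
  have e2 : ∀ y : ℝ, 0 < y → y^ν = y^(2*ν-1) * y^(1-ν) := fun y hy => by rw [← Real.rpow_add hy]; congr 1; ring
  rw [e'] at h1
  simp_rw [e] at h1
  have h3 := h2.mul h1
  have h4 : HasDerivAt (fun x => x^ν * besselK (ν-1) x) ((2*ν-1) * x^(2*ν-1-1) * (x^(1-ν) * besselK (ν-1) x) +
      x^(2*ν-1) * -(x^(1-ν) * besselK ν x)) x := by
    refine h3.congr_of_eventuallyEq ?_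
    filter_upwards [lt_mem_nhds hx] with y hy
    simp only [Pi.mul_apply]
    rw [e2 y hy]; ring
  refine h4.congr_deriv ?_
  rw [e2 x hx, Real.rpow_sub_one hx.ne' (2*ν-1)]
  field_simp
  ring

lemma besselK_exp_tendsto (ν p b : ℝ) (hb : b < 1) :
    Tendsto (fun x => Real.exp (b*x) * (x^p * besselK ν x)) atTop (nhds 0) := by
  have h1 := (tendsto_rpow_mul_exp_neg_mul_atTop_nhds_zero p (1-b) (by linarith)).const_mul (Real.exp 1 * besselK ν 1)
  rw [mul_zero] at h1
  refine squeeze_zero' ?_ ?_ h1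
  · filter_upwards [eventually_ge_atTop 1] with x hx
    have := besselK_nonneg ν x
    have : 0 ≤ x^p := Real.rpow_nonneg (by linarith) _
    positivity
  · filter_upwards [eventually_ge_atTop 1] with x hx
    have h2 := besselK_decay ν x hx
    have : 0 ≤ x^p := Real.rpow_nonneg (by linarith) _
    calc Real.exp (b*x) * (x^p * besselK ν x) ≤ Real.exp (b*x) * (x^p * (Real.exp (-(x-1)) * besselK ν 1)) := by gcongr
      _ = x^p * (Real.exp (b*x) * Real.exp (-(x-1))) * besselK ν 1 := by ring
      _ = x^p * (Real.exp 1 * Real.exp (-(1-b)*x)) * besselK ν 1 := by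
        rw [← Real.exp_add, ← Real.exp_add]; congr 3; ring
      _ = _ := by ring

lemma besselK_continuousOn (ν : ℝ) : ContinuousOn (besselK ν) (Set.Ioi 0) := by
  intro x hx
  have hx : 0 < x := hx
  have h1 := (besselK_hasDerivAt ν x hx).continuousAt
  have h2 : ContinuousAt (fun x : ℝ => x^(-ν)) x := Real.continuousAt_rpow_const _ _ (Or.inl hx.ne')
  refine ContinuousAt.continuousWithinAt ((h2.mul h1).congr ?_)
  filter_upwards [lt_mem_nhds hx] with y hy
  show y ^ (-ν) * (y^ν * besselK ν y) = besselK ν y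
  rw [← mul_assoc, ← Real.rpow_add hy]; simp

lemma nonneg_of_deriv_nonpos_tendsto (f f' : ℝ → ℝ) (hd : ∀ x, 0 < x → HasDerivAt f (f' x) x)
    (hf : ∀ x, 0 < x → f' x ≤ 0) (hl : Tendsto f atTop (nhds 0)) (x : ℝ) (hx : 0 < x) : 0 ≤ f x := by
  have hm : AntitoneOn f (Set.Ioi 0) := by
    refine antitoneOn_of_deriv_nonpos (convex_Ioi 0) (fun y hy => (hd y hy).continuousAt.continuousWithinAt)
      (fun y hy => (hd y (by simpa using hy)).differentiableAt.differentiableWithinAt) (fun y hy => ?_)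
    rw [interior_Ioi] at hy
    rw [(hd y hy).deriv]
    exact hf y hy
  refine le_of_tendsto hl ?_
  filter_upwards [eventually_ge_atTop x] with y hy
  exact hm (Set.mem_Ioi.2 hx) (Set.mem_Ioi.2 (hx.trans_le hy)) hy

lemma wronskian_aux (ν : ℝ) (hν : -1/2 ≤ ν) (x : ℝ) (hx : 0 < x) :
    GI ν x * (x^(ν+1) * besselK (ν+1) x) + HI ν x * (x^(ν+1) * besselK ν x) = 2^ν := by
  have hν' : -1 < ν := by linarith
  set W : ℝ → ℝ := fun x => GI ν x * (x^(ν+1) * besselK (ν+1) x) + HI ν x * (x^(ν+1) * besselK ν x) with hW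
  have hd : ∀ y, 0 < y → HasDerivAt W 0 y := by
    intro y hy
    have h1 := besselK_hasDerivAt (ν+1) y hy
    have h2 := besselK_hasDerivAt' (ν+1) y hy
    simp only [add_sub_cancel_right] at h1 h2
    have := ((GI_hasDerivAt ν hν' y).mul h1).add ((HI_hasDerivAt ν hν' y hy).mul h2)
    refine this.congr_deriv ?_
    field_simp
    ring
  obtain ⟨c, hc⟩ : ∃ c, ∀ y ∈ Set.Ioi (0:ℝ), W y = c := by
    refine ⟨W 1, fun y hy => ?_⟩
    exact isOpen_Ioi.is_const_of_deriv_eq_zero (convex_Ioi (0:ℝ)).isPreconnected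
      (fun z hz => (hd z hz).differentiableAt.differentiableWithinAt)
      (fun z hz => (hd z hz).deriv) hy (Set.mem_Ioi.2 one_pos)
  have ht1 : Tendsto W (nhdsWithin 0 (Set.Ioi 0)) (nhds c) := by
    refine tendsto_const_nhds.congr' ?_
    filter_upwards [self_mem_nhdsWithin] with y hy
    exact (hc y hy).symm
  have hK := besselK_tendsto_zero (ν+1) (by linarith)
  have hG : Tendsto (GI ν) (nhdsWithin 0 (Set.Ioi 0)) (nhds (GI ν 0)) :=
    ((GI_continuous ν hν').tendsto 0).mono_left nhdsWithin_le_nhds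
  have hH : Tendsto (HI ν) (nhdsWithin 0 (Set.Ioi 0)) (nhds (HI ν 0)) :=
    ((HI_continuous ν hν').tendsto 0).mono_left nhdsWithin_le_nhds
  have h0 : HI ν 0 = 0 := by simp [HI]
  rw [h0] at hH
  have hHK : Tendsto (fun x => HI ν x * (x^(ν+1) * besselK ν x)) (nhdsWithin 0 (Set.Ioi 0)) (nhds 0) := by
    have := hH.mul hK
    rw [zero_mul] at this
    refine squeeze_zero' ?_ ?_ this
    · filter_upwards [self_mem_nhdsWithin] with y hy
      have hy : 0 < y := hy
      have := HI_nonneg ν hν' y hy.le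
      have := besselK_nonneg ν y
      positivity
    · filter_upwards [self_mem_nhdsWithin] with y hy
      have hy : 0 < y := hy
      have h1 := HI_nonneg ν hν' y hy.le
      have : besselK ν y ≤ besselK (ν+1) y := besselK_mono _ _ _ hy (by
        rw [abs_of_nonneg (by linarith : 0 ≤ ν + 1), abs_le]; constructor <;> linarith)
      gcongr
  have ht2 := (hG.mul hK).add hHK
  have := tendsto_nhds_unique ht1 ht2
  have hfin := hc x hx
  show W x = 2^ν
  rw [hfin, this]
  have hg : 0 < Real.Gamma (ν+1) := Real.Gamma_pos_of_pos (by linarith)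
  simp only [GI, ne_eq, OfNat.ofNat_ne_zero, not_false_eq_true, zero_pow, zero_div, bphi_zero, add_sub_cancel_right, add_zero]
  field_simp

lemma wronskian (ν : ℝ) (hν : -1/2 ≤ ν) (x : ℝ) (hx : 0 < x) :
    x * (besselI ν x * besselK (ν+1) x + besselI (ν+1) x * besselK ν x) = 1 := by
  have h := wronskian_aux ν hν x hx
  rw [besselI_eq_GI ν x hx, besselI_eq_HI ν x hx, Real.div_rpow hx.le (by norm_num)]
  rw [Real.rpow_add hx, Real.rpow_one] at h
  have : (0:ℝ) < 2^ν := by positivity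
  field_simp
  linarith

lemma KI_sum_le (ν : ℝ) (hν : -1/2 ≤ ν) (x : ℝ) (hx : 0 < x) :
    x * ((besselI ν x + besselI (ν+1) x) * besselK ν x) ≤ 1 := by
  refine le_trans ?_ (wronskian ν hν x hx).le
  have h1 := GI_pos ν (by linarith) x
  have hI : 0 ≤ besselI ν x := by
    rw [besselI_eq_GI ν x hx]; positivity
  have : besselK ν x ≤ besselK (ν+1) x := besselK_mono _ _ _ hx (by
        rw [abs_of_nonneg (by linarith : 0 ≤ ν + 1), abs_le]; constructor <;> linarith)
  rw [add_mul]
  gcongr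

lemma K_le (ν : ℝ) (hν : 1/2 ≤ ν) (x : ℝ) (hx : 0 < x) : x^ν * besselK (ν-1) x ≤ x^ν * besselK ν x := by
  have := besselK_mono (ν-1) ν x hx (by rw [abs_of_nonneg (by linarith : 0 ≤ ν), abs_le]; constructor <;> linarith)
  gcongr

lemma K_ge (ν : ℝ) (h0 : -1/2 ≤ ν) (hν : ν ≤ 1/2) (x : ℝ) (hx : 0 < x) : x^ν * besselK ν x ≤ x^ν * besselK (ν-1) x := by
  have := besselK_mono ν (ν-1) x hx (by rw [abs_of_nonpos (by linarith : ν - 1 ≤ 0), abs_le]; constructor <;> linarith)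
  gcongr

lemma mul_rpow_K (ν p x : ℝ) (hx : 0 < x) : x * (x^p * besselK ν x) = x^(p+1) * besselK ν x := by
  rw [Real.rpow_add hx, Real.rpow_one]; ring

lemma KU (ν : ℝ) (hν : 1/2 ≤ ν) (x : ℝ) (hx : 0 < x) :
    x * besselK ν x ≤ x * besselK (ν-1) x + (ν - 1/2) * besselK ν x := by
  have key := nonneg_of_deriv_nonpos_tendsto
    (fun x => Real.exp (-x) * (x * (x^ν * besselK (ν-1) x) - x * (x^ν * besselK ν x) + (ν-1/2) * (x^ν * besselK ν x)))
    (fun x => Real.exp (-x) * ((ν+1/2) * (x^ν * besselK (ν-1) x - x^ν * besselK ν x)))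
    (fun y hy => by
      have h1 := besselK_hasDerivAt ν y hy
      have h2 := besselK_hasDerivAt' ν y hy
      have h3 : HasDerivAt (fun y : ℝ => Real.exp (-y)) (-Real.exp (-y)) y := by
        simpa using (hasDerivAt_neg y).exp
      have := h3.mul ((((hasDerivAt_id y).mul h2).sub ((hasDerivAt_id y).mul h1)).add (h1.const_mul (ν-1/2)))
      refine this.congr_deriv ?_
      simp
      field_simp
      ring)
    (fun y hy => by
      have := K_le ν hν y hy
      refine mul_nonpos_of_nonneg_of_nonpos (Real.exp_pos _).le (mul_nonpos_of_nonneg_of_nonpos (by linarith) (by linarith)))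
    (by
      have h1 := besselK_exp_tendsto (ν-1) (ν+1) (-1) (by norm_num)
      have h2 := besselK_exp_tendsto ν (ν+1) (-1) (by norm_num)
      have h3 := (besselK_exp_tendsto ν ν (-1) (by norm_num)).const_mul (ν-1/2)
      have := (h1.sub h2).add h3
      simp only [sub_zero, mul_zero, add_zero] at this
      refine this.congr' ?_
      filter_upwards [eventually_gt_atTop 0] with y hy
      rw [← mul_rpow_K _ _ _ hy, ← mul_rpow_K _ _ _ hy]
      simp only [neg_mul, one_mul]
      ring) x hx
  have h0 : 0 < x^ν := Real.rpow_pos_of_pos hx _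
  have : Real.exp (-x) * (x * (x^ν * besselK (ν-1) x) - x * (x^ν * besselK ν x) + (ν-1/2) * (x^ν * besselK ν x))
     = (Real.exp (-x) * x^ν) * (x * besselK (ν-1) x - x * besselK ν x + (ν-1/2) * besselK ν x) := by ring
  simp only [this] at key
  have := nonneg_of_mul_nonneg_right key (by positivity)
  linarith

/-- `x I K ≤ 1/2`. -/
lemma IK_half (ν : ℝ) (hν : 1/2 ≤ ν) (x : ℝ) (hx : 0 < x) : x * (besselI ν x * besselK ν x) ≤ 1/2 := by
  have h1 := wronskian ν (by linarith) x hx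
  have h2 := KU ν hν x hx
  have h3 := GI_HI_lower ν hν x hx.le
  have hp : 0 < (x/2)^ν := by positivity
  have h4 : x * besselI ν x ≤ x * besselI (ν+1) x + (ν+1/2) * besselI ν x := by
    rw [besselI_eq_GI ν x hx, besselI_eq_HI ν x hx]
    nlinarith
  have h5 : besselK (ν+1) x * x = 2 * ν * besselK ν x + x * besselK (ν-1) x := by
    have d1 := besselK_hasDerivAt ν x hx
    have d2 := besselK_hasDerivAt' (ν+1) x hx
    simp only [add_sub_cancel_right] at d2
    have d3 := (hasDerivAt_id x).mul d1
    have d4 : HasDerivAt (fun x => x^(ν+1) * besselK ν x) (1 * (x^ν * besselK ν x) + x * -(x^ν * besselK (ν-1) x)) x := by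
      refine d3.congr_of_eventuallyEq ?_
      filter_upwards [lt_mem_nhds hx] with y hy
      exact (mul_rpow_K ν ν y hy).symm
    have := d4.unique d2
    rw [Real.rpow_add hx, Real.rpow_one] at this
    have hp : 0 < x^ν := by positivity
    field_simp at this
    linarith
  have hK := besselK_pos ν x hx
  have hI : 0 < besselI ν x := by
    rw [besselI_eq_GI ν x hx]; have := GI_pos ν (by linarith) x; positivity
  have h6 := mul_le_mul_of_nonneg_right h4 hK.le
  have h7 := mul_le_mul_of_nonneg_left h2 hI.le
  nlinarith

lemma KY (ν : ℝ) (hν : 1/2 ≤ ν) (x : ℝ) (hx : 0 < x) :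
    0 ≤ x * (x^ν * besselK (ν-1) x)^2 + (2*ν-1) * (x^ν * besselK (ν-1) x) * (x^ν * besselK ν x) - x * (x^ν * besselK ν x)^2 := by
  have key := nonneg_of_deriv_nonpos_tendsto
    (fun x => x^(1-2*ν) * (x * ((x^ν * besselK (ν-1) x)*(x^ν * besselK (ν-1) x)) + (2*ν-1) * ((x^ν * besselK (ν-1) x) * (x^ν * besselK ν x)) - x * ((x^ν * besselK ν x) * (x^ν * besselK ν x))))
    (fun x => x^(1-2*ν) * ((x^ν * besselK (ν-1) x)^2 - (x^ν * besselK ν x)^2))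
    (fun y hy => by
      have h1 := besselK_hasDerivAt ν y hy
      have h2 := besselK_hasDerivAt' ν y hy
      have h3 : HasDerivAt (fun y : ℝ => y^(1-2*ν)) ((1-2*ν) * y^(1-2*ν-1)) y := Real.hasDerivAt_rpow_const (Or.inl hy.ne')
      have := h3.mul ((((hasDerivAt_id y).mul (h2.mul h2)).add ((h2.mul h1).const_mul (2*ν-1))).sub ((hasDerivAt_id y).mul (h1.mul h1)))
      refine this.congr_deriv ?_
      rw [Real.rpow_sub_one hy.ne' (1-2*ν)]
      simp
      field_simp
      ring)
    (fun y hy => by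
      have := K_le ν hν y hy
      have h2 : 0 ≤ y^ν * besselK (ν-1) y := mul_nonneg (by positivity) (besselK_nonneg _ _)
      refine mul_nonpos_of_nonneg_of_nonpos (by positivity) ?_
      nlinarith)
    (by
      have h0 : ∀ μ p : ℝ, Tendsto (fun x => x^p * besselK μ x) atTop (nhds 0) := fun μ p => by
        simpa using besselK_exp_tendsto μ p 0 (by norm_num)
      have := (((h0 (ν-1) (1 + (1 - 2*ν) + ν)).mul (h0 (ν-1) ν)).add
        (((h0 (ν-1) ((1 - 2*ν) + ν)).mul (h0 ν ν)).const_mul (2*ν-1))).sub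
        ((h0 ν (1 + (1 - 2*ν) + ν)).mul (h0 ν ν))
      simp only [sub_zero, mul_zero, add_zero] at this
      refine this.congr' ?_
      filter_upwards [eventually_gt_atTop 0] with y hy
      rw [Real.rpow_add hy, Real.rpow_add hy, Real.rpow_add hy, Real.rpow_one]
      ring) x hx
  have h0 : 0 < x^(1-2*ν) := Real.rpow_pos_of_pos hx _
  have := nonneg_of_mul_nonneg_right key h0
  linarith

/-- the tail integral -/
noncomputable def Qt (ν b x : ℝ) : ℝ := ∫ t in Set.Ioi x, Real.exp (b*t) * (t^ν * besselK ν t)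

lemma gcont (ν b : ℝ) : ContinuousOn (fun t => Real.exp (b*t) * (t^ν * besselK ν t)) (Set.Ioi 0) := by
  have h1 := besselK_continuousOn ν
  have h2 : ContinuousOn (fun t : ℝ => t^ν) (Set.Ioi 0) := fun t ht =>
    (Real.continuousAt_rpow_const _ _ (Or.inl (ne_of_gt ht))).continuousWithinAt
  have h3 : Continuous (fun t : ℝ => Real.exp (b*t)) := by fun_prop
  exact h3.continuousOn.mul (h2.mul h1)

lemma Qt_eq (ν b : ℝ) (hi : IntegrableOn (fun t => Real.exp (b*t) * (t^ν * besselK ν t)) (Set.Ioi 0)) (x : ℝ) (hx : 0 < x) :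
    Qt ν b x = Qt ν b 0 - ∫ t in (0:ℝ)..x, Real.exp (b*t) * (t^ν * besselK ν t) := by
  have hii : IntervalIntegrable (fun t => Real.exp (b*t) * (t^ν * besselK ν t)) volume 0 x := by
    rw [intervalIntegrable_iff_integrableOn_Ioc_of_le hx.le]
    exact hi.mono_set Set.Ioc_subset_Ioi_self
  have := intervalIntegral.integral_interval_add_Ioi hi (hi.mono_set (Set.Ioi_subset_Ioi hx.le))
  unfold Qt
  linarith

lemma Qt_hasDerivAt (ν b : ℝ) (hi : IntegrableOn (fun t => Real.exp (b*t) * (t^ν * besselK ν t)) (Set.Ioi 0)) (x : ℝ) (hx : 0 < x) :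
    HasDerivAt (Qt ν b) (-(Real.exp (b*x) * (x^ν * besselK ν x))) x := by
  have hii : IntervalIntegrable (fun t => Real.exp (b*t) * (t^ν * besselK ν t)) volume 0 x := by
    rw [intervalIntegrable_iff_integrableOn_Ioc_of_le hx.le]
    exact hi.mono_set Set.Ioc_subset_Ioi_self
  have hd := intervalIntegral.integral_hasDerivAt_right hii
    ((gcont ν b).stronglyMeasurableAtFilter isOpen_Ioi x hx) ((gcont ν b).continuousAt (Ioi_mem_nhds hx))
  refine ((hd.const_sub (Qt ν b 0))).congr_of_eventuallyEq ?_
  filter_upwards [lt_mem_nhds hx] with y hy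
  exact Qt_eq ν b hi y hy

lemma Qt_tendsto (ν b : ℝ) (hi : IntegrableOn (fun t => Real.exp (b*t) * (t^ν * besselK ν t)) (Set.Ioi 0)) :
    Tendsto (Qt ν b) atTop (nhds 0) := by
  have := (intervalIntegral_tendsto_integral_Ioi 0 hi tendsto_id).const_sub (Qt ν b 0)
  have e : Qt ν b 0 - ∫ t in Set.Ioi (0:ℝ), Real.exp (b*t) * (t^ν * besselK ν t) = 0 := by simp [Qt]
  rw [e] at this
  refine this.congr' ?_
  filter_upwards [eventually_gt_atTop 0] with y hy
  exact (Qt_eq ν b hi y hy).symm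

lemma Qt_nonneg (ν b x : ℝ) (hx : 0 ≤ x) : 0 ≤ Qt ν b x := by
  refine setIntegral_nonneg measurableSet_Ioi (fun t ht => ?_)
  have : 0 < t := lt_of_le_of_lt hx ht
  have := besselK_nonneg ν t
  positivity

lemma upper_small (ν b : ℝ) (h0 : -1/2 ≤ ν) (hν : ν ≤ 1/2) (hb : b < 1)
    (hi : IntegrableOn (fun t => Real.exp (b*t) * (t^ν * besselK ν t)) (Set.Ioi 0)) (x : ℝ) (hx : 0 < x) :
    Qt ν b x ≤ (1-b)⁻¹ * (Real.exp (b*x) * (x^ν * besselK ν x)) := by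
  have hb' : 0 < 1 - b := by linarith
  have key := nonneg_of_deriv_nonpos_tendsto
    (fun x => (1-b)⁻¹ * (Real.exp (b*x) * (x^ν * besselK ν x)) - Qt ν b x)
    (fun x => (1-b)⁻¹ * (Real.exp (b*x) * b * (x^ν * besselK ν x) + Real.exp (b*x) * -(x^ν * besselK (ν-1) x))
      - -(Real.exp (b*x) * (x^ν * besselK ν x)))
    (fun y hy => by
      have h1 : HasDerivAt (fun t : ℝ => Real.exp (b*t)) (Real.exp (b*y) * b) y := by
        simpa using ((hasDerivAt_id y).const_mul b).exp
      exact ((h1.mul (besselK_hasDerivAt ν y hy)).const_mul _).sub (Qt_hasDerivAt ν b hi y hy))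
    (fun y hy => by
      have := K_ge ν h0 hν y hy
      have e : (1-b)⁻¹ * (Real.exp (b*y) * b * (y^ν * besselK ν y) + Real.exp (b*y) * -(y^ν * besselK (ν-1) y))
      - -(Real.exp (b*y) * (y^ν * besselK ν y)) = (1-b)⁻¹ * Real.exp (b*y) * (y^ν * besselK ν y - y^ν * besselK (ν-1) y) := by
        field_simp
        ring
      rw [e]
      exact mul_nonpos_of_nonneg_of_nonpos (by positivity) (by linarith))
    (by
      have := ((besselK_exp_tendsto ν ν b hb).const_mul (1-b)⁻¹).sub (Qt_tendsto ν b hi)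
      simpa using this) x hx
  simpa using key

lemma upper_large (ν b T : ℝ) (hν : 1/2 ≤ ν) (hb : b < 1)
    (hi : IntegrableOn (fun t => Real.exp (b*t) * (t^ν * besselK ν t)) (Set.Ioi 0))
    (hT : ∀ y, 0 < y → Qt ν b y ≤ T) (x : ℝ) (hx : 0 < x) :
    Qt ν b x ≤ T / (2^(ν-1) * Real.Gamma ν) * (Real.exp (b*x) * (x^ν * besselK ν x)) := by
  have hG : ∀ y, 0 < y → 0 < y^ν * besselK ν y := fun y hy => mul_pos (by positivity) (besselK_pos ν y hy)
  have he : ∀ y, HasDerivAt (fun t : ℝ => Real.exp (b*t)) (Real.exp (b*y) * b) y := fun y => by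
    simpa using ((hasDerivAt_id y).const_mul b).exp
  have hZ : ∀ y, 0 < y → 0 ≤ Real.exp (b*y) * (y^ν * besselK ν y) -
      Qt ν b y * ((y^ν * besselK (ν-1) y) / (y^ν * besselK ν y) - b) := by
    intro y hy
    refine nonneg_of_deriv_nonpos_tendsto (fun y => Real.exp (b*y) * (y^ν * besselK ν y) -
      Qt ν b y * ((y^ν * besselK (ν-1) y) / (y^ν * besselK ν y) - b))
      (fun y => - (Qt ν b y * ((y * (y^ν * besselK (ν-1) y)^2 + (2*ν-1) * (y^ν * besselK (ν-1) y) * (y^ν * besselK ν y) - y * (y^ν * besselK ν y)^2) / (y * (y^ν * besselK ν y)^2)))) ?_ ?_ ?_ y hy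
    · intro y hy
      have h1 := besselK_hasDerivAt ν y hy
      have h2 := besselK_hasDerivAt' ν y hy
      have := ((he y).mul h1).sub ((Qt_hasDerivAt ν b hi y hy).mul ((h2.div h1 (hG y hy).ne').sub_const b))
      refine this.congr_deriv ?_
      have hGy := (hG y hy).ne'
      simp only [Pi.div_apply]
      generalize y^ν * besselK ν y = g at *
      generalize y^ν * besselK (ν-1) y = h at *
      field_simp
      ring
    · intro y hy
      have h1 := KY ν hν y hy
      have h2 := Qt_nonneg ν b y hy.le
      have h3 := hG y hy
      rw [neg_nonpos]
      refine mul_nonneg h2 (div_nonneg h1 (by positivity))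
    · have h1 := besselK_exp_tendsto ν ν b hb
      have h2 := Qt_tendsto ν b hi
      have h3 : Tendsto (fun y => Qt ν b y * ((y^ν * besselK (ν-1) y) / (y^ν * besselK ν y) - b)) atTop (nhds 0) := by
        refine Tendsto.zero_mul_isBoundedUnder_le h2 ?_
        refine isBoundedUnder_of_eventually_le (a := 1 + |b|) ?_
        filter_upwards [eventually_gt_atTop 0] with y hy
        refine (norm_sub_le _ _).trans ?_
        gcongr
        · have := K_le ν hν y hy
          rw [Real.norm_eq_abs, abs_of_nonneg (div_nonneg (mul_nonneg (by positivity) (besselK_nonneg _ _)) (hG y hy).le), div_le_one (hG y hy)]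
          exact this
        · exact le_rfl
      simpa using h1.sub h3
  have hanti : AntitoneOn (fun y => Qt ν b y / (Real.exp (b*y) * (y^ν * besselK ν y))) (Set.Ioi 0) := by
    have hd : ∀ y, 0 < y → HasDerivAt (fun y => Qt ν b y / (Real.exp (b*y) * (y^ν * besselK ν y)))
        (- (Real.exp (b*y) * (y^ν * besselK ν y) -
      Qt ν b y * ((y^ν * besselK (ν-1) y) / (y^ν * besselK ν y) - b)) / (Real.exp (b*y) * (y^ν * besselK ν y))) y := by
      intro y hy
      have h1 := besselK_hasDerivAt ν y hy
      have hGy := (hG y hy).ne'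
      have := (Qt_hasDerivAt ν b hi y hy).div ((he y).mul h1) (mul_ne_zero (Real.exp_pos _).ne' hGy)
      refine this.congr_deriv ?_
      simp only [Pi.mul_apply]
      generalize y^ν * besselK ν y = g at *
      generalize y^ν * besselK (ν-1) y = h at *
      have := (Real.exp_pos (b*y)).ne'
      field_simp
      ring
    refine antitoneOn_of_deriv_nonpos (convex_Ioi 0) (fun y hy => (hd y hy).continuousAt.continuousWithinAt)
      (fun y hy => (hd y (by simpa using hy)).differentiableAt.differentiableWithinAt) (fun y hy => ?_)
    rw [interior_Ioi] at hy
    rw [(hd y hy).deriv]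
    have h3 := hG y hy
    exact div_nonpos_of_nonpos_of_nonneg (neg_nonpos.2 (hZ y hy)) (by positivity)
  have hΓ : 0 < Real.Gamma ν := Real.Gamma_pos_of_pos (by linarith)
  have hlim : Tendsto (fun y => T / (Real.exp (b*y) * (y^ν * besselK ν y))) (nhdsWithin 0 (Set.Ioi 0))
      (nhds (T / (1 * (2^(ν-1) * Real.Gamma ν)))) := by
    refine tendsto_const_nhds.div (Tendsto.mul ?_ (besselK_tendsto_zero ν (by linarith))) (by positivity)
    have : Continuous fun y : ℝ => Real.exp (b*y) := by fun_prop
    have := this.tendsto 0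
    simp only [mul_zero, Real.exp_zero] at this
    exact this.mono_left nhdsWithin_le_nhds
  rw [one_mul] at hlim
  rw [← div_le_iff₀ (mul_pos (Real.exp_pos _) (hG x hx))]
  refine ge_of_tendsto hlim ?_
  filter_upwards [Ioo_mem_nhdsGT hx] with y hy
  refine (hanti hy.1 hx hy.2.le).trans ?_
  have h3 := hG y hy.1
  have := hT y hy.1
  simp only
  gcongr

noncomputable def Ffub (ν b t s : ℝ) : ℝ := Real.exp (b*t) * (s^(ν-1) * Real.exp (-s - (t^2/4)/s))

lemma Ffub_eq (ν b t s : ℝ) (hs : 0 < s) :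
    Ffub ν b t s = (s^(ν-1) * Real.exp (-((1-b^2)*s))) * Real.exp (-(1/(4*s)) * (t - 2*b*s)^2) := by
  unfold Ffub
  rw [mul_left_comm, mul_assoc, ← Real.exp_add, ← Real.exp_add]
  congr 2
  field_simp
  ring

lemma Ffub_int (ν b s : ℝ) (hs : 0 < s) : Integrable (fun t => Ffub ν b t s) := by
  simp_rw [Ffub_eq ν b _ s hs]
  have h4 : 0 < 1/(4*s) := by positivity
  exact ((integrable_exp_neg_mul_sq h4).comp_sub_right (2*b*s)).const_mul _

lemma Ffub_integral (ν b s : ℝ) (hs : 0 < s) :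
    ∫ t, Ffub ν b t s = 2 * √π * (s^((ν+1/2)-1) * Real.exp (-((1-b^2)*s))) := by
  simp_rw [Ffub_eq ν b _ s hs]
  rw [integral_const_mul, integral_sub_right_eq_self (fun t => Real.exp (-(1/(4*s)) * t^2)) (2*b*s),
    integral_gaussian]
  have e : π / (1/(4*s)) = π * (2^2 * s) := by field_simp; norm_num
  rw [e, Real.sqrt_mul Real.pi_pos.le, Real.sqrt_mul (by positivity), Real.sqrt_sq (by norm_num)]
  rw [show ν + 1/2 - 1 = (ν - 1) + 1/2 by ring, Real.rpow_add hs, ← Real.sqrt_eq_rpow]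
  ring

lemma Ffub_nonneg (ν b t s : ℝ) (hs : 0 < s) : 0 ≤ Ffub ν b t s := by
  unfold Ffub; positivity

lemma gamma_int (ν b : ℝ) (hν : -1/2 < ν) (hb : b^2 < 1) :
    Integrable (fun s : ℝ => 2 * √π * (s^((ν+1/2)-1) * Real.exp (-((1-b^2)*s)))) (volume.restrict (Set.Ioi 0)) := by
  refine Integrable.const_mul ?_ _
  have hb' : 0 < 1 - b^2 := by linarith
  have := integrableOn_rpow_mul_exp_neg_mul_rpow (p := 1) (s := (ν+1/2)-1) (b := 1-b^2) (by linarith) one_pos hb'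
  simp only [Real.rpow_one, neg_mul] at this
  exact this

lemma Ffub_prod (ν b : ℝ) (hν : -1/2 < ν) (hb : b^2 < 1) :
    Integrable (Function.uncurry (Ffub ν b)) ((volume : Measure ℝ).prod (volume.restrict (Set.Ioi 0))) := by
  have hm : Measurable (Function.uncurry (Ffub ν b)) := by
    unfold Ffub Function.uncurry
    fun_prop
  rw [integrable_prod_iff' hm.aestronglyMeasurable]
  constructor
  · filter_upwards [ae_restrict_mem measurableSet_Ioi] with s hs
    exact Ffub_int ν b s hs
  · refine (gamma_int ν b hν hb).congr ?_
    filter_upwards [ae_restrict_mem measurableSet_Ioi] with s hs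
    rw [← Ffub_integral ν b s hs]
    refine integral_congr_ae (ae_of_all _ fun t => ?_)
    exact (Real.norm_of_nonneg (Ffub_nonneg ν b t s hs)).symm

lemma wt_ae (ν b : ℝ) : (fun t : ℝ => 2^(ν-1) * ∫ s in Set.Ioi 0, Ffub ν b t s) =ᵐ[volume]
    fun t : ℝ => Real.exp (b*t) * (|t|^ν * besselK ν |t|) := by
  have : ∀ᵐ t : ℝ, t ≠ 0 := by
    simp [ae_iff]
  filter_upwards [this] with t ht
  rw [besselK_mix ν |t| (abs_pos.2 ht), sq_abs]
  unfold Ffub kmix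
  rw [integral_const_mul]
  ring

lemma wt_integrable (ν b : ℝ) (hν : -1/2 < ν) (hb : b^2 < 1) :
    Integrable (fun t : ℝ => Real.exp (b*t) * (|t|^ν * besselK ν |t|)) := by
  have := ((Ffub_prod ν b hν hb).integral_prod_left).const_mul (2^(ν-1))
  exact this.congr (wt_ae ν b)

lemma wt_integral (ν b : ℝ) (hν : -1/2 < ν) (hb : b^2 < 1) :
    ∫ t : ℝ, Real.exp (b*t) * (|t|^ν * besselK ν |t|) =
      √π * 2^ν * Real.Gamma (ν+1/2) / (1-b^2)^(ν+1/2) := by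
  have hb' : 0 < 1 - b^2 := by linarith
  rw [← integral_congr_ae (wt_ae ν b), integral_const_mul, integral_integral_swap (Ffub_prod ν b hν hb)]
  rw [setIntegral_congr_fun measurableSet_Ioi (fun s hs => Ffub_integral ν b s hs), integral_const_mul,
    Real.integral_rpow_mul_exp_neg_mul_Ioi (by linarith) hb', Real.rpow_sub_one (by norm_num),
    Real.div_rpow (by norm_num) hb'.le, Real.one_rpow]
  field_simp

lemma wt_Ioi (ν b : ℝ) (hν : -1/2 < ν) (hb : b^2 < 1) :
    IntegrableOn (fun t => Real.exp (b*t) * (t^ν * besselK ν t)) (Set.Ioi 0) := by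
  refine (wt_integrable ν b hν hb).integrableOn.congr_fun (fun t ht => ?_) measurableSet_Ioi
  have ht : 0 < t := ht
  simp only [abs_of_pos ht]

lemma Qt_le_total (ν b : ℝ) (hν : -1/2 < ν) (hb : b^2 < 1) (x : ℝ) (hx : 0 < x) :
    Qt ν b x ≤ √π * 2^ν * Real.Gamma (ν+1/2) / (1-b^2)^(ν+1/2) := by
  rw [← wt_integral ν b hν hb]
  have : Qt ν b x = ∫ t in Set.Ioi x, Real.exp (b*t) * (|t|^ν * besselK ν |t|) := by
    refine setIntegral_congr_fun measurableSet_Ioi (fun t ht => ?_)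
    have ht : 0 < t := hx.trans ht
    simp only [abs_of_pos ht]
  rw [this]
  refine setIntegral_le_integral (wt_integrable ν b hν hb) (ae_of_all _ fun t => ?_)
  have := besselK_nonneg ν |t|
  show 0 ≤ Real.exp (b*t) * (|t|^ν * besselK ν |t|)
  positivity

noncomputable def Lw (ν b x : ℝ) : ℝ := ∫ t in (0:ℝ)..x, Real.exp (b*t) * (t^ν * besselI ν t)

lemma I_fun_eq (r t : ℝ) (ht : 0 < t) : t^((r-1)/2) * besselI ((r-1)/2) t =
    (2^((r-1)/2))⁻¹ * (t^(r-1) * GI ((r-1)/2) t) := by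
  rw [besselI_eq_GI _ t ht, Real.div_rpow ht.le (by norm_num), show t^(r-1) = t^((r-1)/2) * t^((r-1)/2) by
    rw [← Real.rpow_add ht]; congr 1; ring]
  have : (0:ℝ) < 2^((r-1)/2) := by positivity
  field_simp

lemma Lw_integrable (r b x : ℝ) (hr : 0 < r) (hx : 0 < x) :
    IntervalIntegrable (fun t => Real.exp (b*t) * (t^((r-1)/2) * besselI ((r-1)/2) t)) volume 0 x := by
  have := (lower_integrable r b x hr).const_mul (2^((r-1)/2))⁻¹
  refine this.congr ?_
  intro t ht
  rw [Set.uIoc_of_le hx.le] at ht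
  show _ = _
  simp only
  rw [I_fun_eq r t ht.1]
  ring

lemma Lw_eq (r b x : ℝ) (hx : 0 < x) :
    Lw ((r-1)/2) b x = (2^((r-1)/2))⁻¹ * ∫ t in (0:ℝ)..x, Real.exp (b*t) * t^(r-1) * GI ((r-1)/2) t := by
  rw [← intervalIntegral.integral_const_mul]
  refine intervalIntegral.integral_congr_ae (ae_of_all _ fun t ht => ?_)
  rw [Set.uIoc_of_le hx.le] at ht
  rw [I_fun_eq r t ht.1]
  ring

lemma Lw_large (r b x : ℝ) (hr : 2 ≤ r) (hx : 0 < x) (hb : -1 < b) :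
    Lw ((r-1)/2) b x ≤ (1+b)⁻¹ * (Real.exp (b*x) * (x^((r-1)/2) * besselI ((r-1)/2) x)) := by
  rw [Lw_eq r b x hx, I_fun_eq r x hx]
  have := lower_int_large r b x hr hx (lower_integrable r b x (by linarith)) hb
  calc _ ≤ (2^((r-1)/2))⁻¹ * ((1+b)⁻¹*(Real.exp (b*x)*x^(r-1)*GI ((r-1)/2) x)) := by gcongr
    _ = _ := by ring

lemma Lw_small (r b x : ℝ) (hr0 : 0 < r) (hr : r ≤ 2) (hx : 0 < x) (hb : -1 < b) :
    Lw ((r-1)/2) b x ≤ (1+b)⁻¹ * (2/r) * (Real.exp (b*x) * (x^((r-1)/2) * (besselI ((r-1)/2) x + besselI ((r-1)/2+1) x))) := by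
  rw [Lw_eq r b x hx, mul_add, I_fun_eq r x hx]
  have e : x^((r-1)/2) * besselI ((r-1)/2+1) x = (2^((r-1)/2))⁻¹ * (x^(r-1) * HI ((r-1)/2) x) := by
    rw [besselI_eq_HI _ x hx, Real.div_rpow hx.le (by norm_num), show x^(r-1) = x^((r-1)/2) * x^((r-1)/2) by
      rw [← Real.rpow_add hx]; congr 1; ring]
    have : (0:ℝ) < 2^((r-1)/2) := by positivity
    field_simp
  rw [e]
  have := lower_int_small r b x hr0 hr hx (lower_integrable r b x hr0) hb
  calc _ ≤ (2^((r-1)/2))⁻¹ * ((1+b)⁻¹*(2/r)*(Real.exp (b*x)*x^(r-1)*(GI ((r-1)/2) x + HI ((r-1)/2) x))) := by gcongr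
    _ = _ := by ring

lemma gamma_half (ν : ℝ) (hν : 0 < ν) : Real.Gamma (ν+1/2) ≤ √ν * Real.Gamma ν := by
  have h := Real.Gamma_mul_add_mul_le_rpow_Gamma_mul_rpow_Gamma (s := ν) (t := ν+1) (a := 1/2) (b := 1/2)
    hν (by linarith) (by norm_num) (by norm_num) (by norm_num)
  have hg := Real.Gamma_pos_of_pos hν
  rw [Real.Gamma_add_one hν.ne', Real.mul_rpow hν.le hg.le, show 1/2*ν+1/2*(ν+1) = ν+1/2 by ring,
    ← Real.sqrt_eq_rpow, ← Real.sqrt_eq_rpow] at h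
  calc _ ≤ _ := h
    _ = √ν * (√(Real.Gamma ν) * √(Real.Gamma ν)) := by ring
    _ = _ := by rw [Real.mul_self_sqrt hg.le]

lemma besselI_nonneg' (ν x : ℝ) (hν : -1 < ν) (hx : 0 < x) : 0 ≤ besselI ν x := by
  have := GI_pos ν hν x
  rw [besselI_eq_GI ν x hx]; positivity

lemma kernel_bound (r b x : ℝ) (hr : 0 < r) (hb : b^2 < 1) (hx : 0 < x) :
    x * Real.exp (-(b*x)) * (x^((r-1)/2))⁻¹ * (1-b^2) *
      (besselK ((r-1)/2) x * Lw ((r-1)/2) b x + besselI ((r-1)/2) x * Qt ((r-1)/2) b x) ≤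
    1 + 6/r + (if 2 ≤ r then √(π*(r-1)/2) * (1/(1-b^2))^(r/2-1) else 2) := by
  have hb1 : -1 < b := by nlinarith
  have hb2 : b < 1 := by nlinarith
  have hp : 0 < 1 + b := by linarith
  have hm : 0 < 1 - b := by linarith
  have hν : -1/2 < (r-1)/2 := by linarith
  have hK := besselK_nonneg ((r-1)/2) x
  have hI := besselI_nonneg' ((r-1)/2) x (by linarith) hx
  have hI' := besselI_nonneg' ((r-1)/2+1) x (by linarith) hx
  have hxν : 0 < x^((r-1)/2) := by positivity
  have hsq : 1 - b^2 = (1+b)*(1-b) := by ring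
  have he : Real.exp (-(b*x)) * Real.exp (b*x) = 1 := by rw [← Real.exp_add]; simp
  have hi := wt_Ioi ((r-1)/2) b hν hb
  have hc : 0 ≤ x * Real.exp (-(b*x)) * (x^((r-1)/2))⁻¹ * (1-b^2) := by
    rw [hsq]; positivity
  -- generic simplification
  have hsimp : ∀ c y z : ℝ, x * Real.exp (-(b*x)) * (x^((r-1)/2))⁻¹ * (1-b^2) * (y * (c * (Real.exp (b*x) * (x^((r-1)/2) * z))))
      = c * (1-b^2) * (x * (z * y)) := by
    intro c y z
    calc _ = (Real.exp (-(b*x)) * Real.exp (b*x)) * ((x^((r-1)/2))⁻¹ * x^((r-1)/2)) * (c * (1-b^2) * (x * (z * y))) := by ring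
      _ = _ := by rw [he, inv_mul_cancel₀ hxν.ne']; ring
  rw [mul_add]
  split_ifs with h2
  · set ν := (r-1)/2 with hνd
    have hν2 : 1/2 ≤ ν := by linarith
    have hik := IK_half ν hν2 x hx
    have s1 : x * Real.exp (-(b*x)) * (x^ν)⁻¹ * (1-b^2) * (besselK ν x * Lw ν b x) ≤ 1 := by
      have := Lw_large r b x h2 hx hb1
      rw [← hνd] at this
      calc _ ≤ x * Real.exp (-(b*x)) * (x^ν)⁻¹ * (1-b^2) * (besselK ν x * ((1+b)⁻¹ * (Real.exp (b*x) * (x^ν * besselI ν x)))) := by gcongr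
        _ = (1-b) * (x * (besselI ν x * besselK ν x)) := by rw [hsimp, hsq]; field_simp
        _ ≤ (1-b) * (1/2) := by gcongr
        _ ≤ 1 := by linarith
    have s2 : x * Real.exp (-(b*x)) * (x^ν)⁻¹ * (1-b^2) * (besselI ν x * Qt ν b x) ≤ √(π*(r-1)/2) * (1/(1-b^2))^(r/2-1) := by
      have hQ := upper_large ν b _ hν2 hb2 hi (fun y hy => Qt_le_total ν b hν hb y hy) x hx
      have hG := Real.Gamma_pos_of_pos (by linarith : 0 < ν)
      have hG' := Real.Gamma_pos_of_pos (by linarith : 0 < ν + 1/2)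
      have hgh := gamma_half ν (by linarith)
      have hb' : 0 < 1 - b^2 := by linarith
      have h1 : √(π*(r-1)/2) = √π * √ν := by rw [← Real.sqrt_mul Real.pi_pos.le, hνd]; congr 1; ring
      have h2 : (1/(1-b^2))^(r/2-1) = (1-b^2) / (1-b^2)^(ν+1/2) := by
        rw [one_div, Real.inv_rpow hb'.le, ← Real.rpow_neg hb'.le]
        nth_rewrite 2 [← Real.rpow_one (1-b^2)]
        rw [← Real.rpow_sub hb']
        congr 1
        rw [hνd]; ring
      rw [h1, h2]
      calc _ ≤ x * Real.exp (-(b*x)) * (x^ν)⁻¹ * (1-b^2) * (besselI ν x * (√π * 2^ν * Real.Gamma (ν+1/2) / (1-b^2)^(ν+1/2) / (2^(ν-1) * Real.Gamma ν) * (Real.exp (b*x) * (x^ν * besselK ν x)))) := by gcongr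
        _ = √π * 2^ν * Real.Gamma (ν+1/2) / (1-b^2)^(ν+1/2) / (2^(ν-1) * Real.Gamma ν) * (1-b^2) * (x * (besselI ν x * besselK ν x)) := by rw [hsimp]; ring
        _ ≤ √π * 2^ν * Real.Gamma (ν+1/2) / (1-b^2)^(ν+1/2) / (2^(ν-1) * Real.Gamma ν) * (1-b^2) * (1/2) := by gcongr
        _ = √π * (Real.Gamma (ν+1/2) / Real.Gamma ν) * ((1-b^2) / (1-b^2)^(ν+1/2)) := by
          rw [Real.rpow_sub_one (by norm_num)]; field_simp
        _ ≤ _ := by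
          gcongr
          rwa [div_le_iff₀ hG]
    have : 0 < 6/r := by positivity
    linarith
  · set ν := (r-1)/2 with hνd
    have hki := KI_sum_le ν hν.le x hx
    have s1 : x * Real.exp (-(b*x)) * (x^ν)⁻¹ * (1-b^2) * (besselK ν x * Lw ν b x) ≤ 6/r := by
      have := Lw_small r b x hr (by linarith) hx hb1
      rw [← hνd] at this
      calc _ ≤ x * Real.exp (-(b*x)) * (x^ν)⁻¹ * (1-b^2) * (besselK ν x * ((1+b)⁻¹ * (2/r) * (Real.exp (b*x) * (x^ν * (besselI ν x + besselI (ν+1) x))))) := by gcongr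
        _ = (1-b) * (2/r) * (x * ((besselI ν x + besselI (ν+1) x) * besselK ν x)) := by rw [hsimp, hsq]; field_simp
        _ ≤ (1-b) * (2/r) * 1 := by gcongr
        _ ≤ 3 * (2/r) * 1 := by gcongr; linarith
        _ = 6/r := by ring
    have s2 : x * Real.exp (-(b*x)) * (x^ν)⁻¹ * (1-b^2) * (besselI ν x * Qt ν b x) ≤ 2 := by
      have hQ := upper_small ν b hν.le (by linarith) hb2 hi x hx
      have hik : x * (besselI ν x * besselK ν x) ≤ 1 := by
        refine le_trans ?_ hki
        gcongr
        linarith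
      calc _ ≤ x * Real.exp (-(b*x)) * (x^ν)⁻¹ * (1-b^2) * (besselI ν x * ((1-b)⁻¹ * (Real.exp (b*x) * (x^ν * besselK ν x)))) := by gcongr
        _ = (1+b) * (x * (besselI ν x * besselK ν x)) := by rw [hsimp, hsq]; field_simp
        _ ≤ (1+b) * 1 := by gcongr
        _ ≤ 2 := by linarith
    linarith

noncomputable def wI (ν α β t : ℝ) : ℝ := Real.exp (β*t) * |t|^ν * besselI ν (α*|t|)
noncomputable def wK (ν α β t : ℝ) : ℝ := Real.exp (β*t) * |t|^ν * besselK ν (α*|t|)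

lemma wK_eq (ν α β t : ℝ) (hα : 0 < α) :
    wK ν α β t = (α^ν)⁻¹ * (Real.exp (β/α*(α*t)) * (|α*t|^ν * besselK ν |α*t|)) := by
  have h : 0 < α^ν := by positivity
  rw [wK, abs_mul, abs_of_pos hα, Real.mul_rpow hα.le (abs_nonneg t), show β/α*(α*t) = β*t by field_simp]
  field_simp

lemma wI_eq (ν α β t : ℝ) (hα : 0 < α) (ht : 0 < t) :
    wI ν α β t = (α^ν)⁻¹ * (Real.exp (β/α*(α*t)) * ((α*t)^ν * besselI ν (α*t))) := by
  have h : 0 < α^ν := by positivity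
  rw [wI, abs_of_pos ht, Real.mul_rpow hα.le ht.le, show β/α*(α*t) = β*t by field_simp]
  field_simp

lemma wK_nonneg (ν α β t : ℝ) : 0 ≤ wK ν α β t := by
  have := besselK_nonneg ν (α*|t|)
  unfold wK; positivity

lemma wI_nonneg (ν α β t : ℝ) (hν : -1 < ν) (hα : 0 < α) (ht : 0 < t) : 0 ≤ wI ν α β t := by
  have := besselI_nonneg' ν (α*|t|) hν (by positivity)
  unfold wI; positivity

lemma wK_integrable (ν α β : ℝ) (hν : -1/2 < ν) (hα : 0 < α) (hb : (β/α)^2 < 1) :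
    Integrable (wK ν α β) := by
  have h := (wt_integrable ν (β/α) hν hb).comp_mul_left' hα.ne'
  refine (h.const_mul (α^ν)⁻¹).congr (ae_of_all _ fun t => ?_)
  exact (wK_eq ν α β t hα).symm

lemma wK_integral (ν α β : ℝ) (hν : -1/2 < ν) (hα : 0 < α) (hb : (β/α)^2 < 1) :
    ∫ t, wK ν α β t = (α^ν)⁻¹ * (α⁻¹ * (√π * 2^ν * Real.Gamma (ν+1/2) / (1-(β/α)^2)^(ν+1/2))) := by
  simp_rw [wK_eq ν α β _ hα]
  rw [integral_const_mul, Measure.integral_comp_mul_left (fun u => Real.exp (β/α*u) * (|u|^ν * besselK ν |u|)) α,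
    wt_integral ν (β/α) hν hb, abs_of_pos (by positivity), smul_eq_mul]

lemma wI_integrable (r α β x : ℝ) (hr : 0 < r) (hα : 0 < α) (hx : 0 < x) :
    IntervalIntegrable (wI ((r-1)/2) α β) volume 0 x := by
  have h := (Lw_integrable r (β/α) (α*x) hr (by positivity)).comp_mul_left (c := α)
  simp only [zero_div, mul_div_cancel_left₀ _ hα.ne'] at h
  refine (h.const_mul (α^((r-1)/2))⁻¹).congr ?_
  intro t ht
  rw [Set.uIoc_of_le hx.le] at ht
  exact (wI_eq _ α β t hα ht.1).symm

lemma wI_integral (ν α β x : ℝ) (hα : 0 < α) (hx : 0 < x) :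
    ∫ t in (0:ℝ)..x, wI ν α β t = (α^ν)⁻¹ * (α⁻¹ * Lw ν (β/α) (α*x)) := by
  have := intervalIntegral.integral_comp_mul_left (a := 0) (b := x) (fun u => Real.exp (β/α*u) * (u^ν * besselI ν u)) hα.ne'
  rw [mul_zero, smul_eq_mul] at this
  unfold Lw
  rw [← this, ← intervalIntegral.integral_const_mul]
  refine intervalIntegral.integral_congr_ae (ae_of_all _ fun t ht => ?_)
  rw [Set.uIoc_of_le hx.le] at ht
  exact wI_eq _ α β t hα ht.1

lemma wK_tail (ν α β x : ℝ) (hα : 0 < α) (hx : 0 < x) :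
    ∫ t in Set.Ioi x, wK ν α β t = (α^ν)⁻¹ * (α⁻¹ * Qt ν (β/α) (α*x)) := by
  have := integral_comp_mul_left_Ioi (fun u => Real.exp (β/α*u) * (u^ν * besselK ν u)) x hα
  rw [smul_eq_mul] at this
  unfold Qt
  rw [← this, ← integral_const_mul]
  refine setIntegral_congr_fun measurableSet_Ioi (fun t ht => ?_)
  have ht : 0 < t := hx.trans ht
  rw [wK_eq _ α β t hα, abs_of_pos (by positivity)]

lemma scaled_bound (r σ α β x : ℝ) (hr : 0 < r) (hα : 0 < α) (hb : (β/α)^2 < 1)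
    (hs : σ^2 * (α^2 * (1 - (β/α)^2)) = 1) (hx : 0 < x) :
    x * (Real.exp (-β*x) / (σ^2 * x^((r-1)/2)) * (besselK ((r-1)/2) (α*x) * (∫ t in (0:ℝ)..x, wI ((r-1)/2) α β t) +
      besselI ((r-1)/2) (α*x) * (∫ t in Set.Ioi x, wK ((r-1)/2) α β t))) ≤
    1 + 6/r + (if 2 ≤ r then √(π*(r-1)/2) * (1/(1-(β/α)^2))^(r/2-1) else 2) := by
  refine le_trans (le_of_eq ?_) (kernel_bound r (β/α) (α*x) hr hb (by positivity))
  rw [wI_integral _ α β x hα hx, wK_tail _ α β x hα hx, Real.mul_rpow hα.le hx.le,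
    show β/α*(α*x) = β*x by field_simp, neg_mul]
  have h1 : 0 < α^((r-1)/2) := by positivity
  have h2 : 0 < x^((r-1)/2) := by positivity
  have hσ : σ^2 ≠ 0 := by intro h; rw [h] at hs; simp at hs
  have hs' : 1 - (β/α)^2 = (σ^2 * α^2)⁻¹ := by
    refine eq_inv_of_mul_eq_one_left ?_; linarith
  rw [hs']
  field_simp

noncomputable def SS (r σ α β : ℝ) (φ : ℝ → ℝ) (x : ℝ) : ℝ :=
  -(Real.exp (-β*x) * besselK ((r-1)/2) (α*|x|) / (σ^2 * |x|^((r-1)/2))) *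
    (∫ t in (0:ℝ)..x, wI ((r-1)/2) α β t * φ t) -
  (Real.exp (-β*x) * besselI ((r-1)/2) (α*|x|) / (σ^2 * |x|^((r-1)/2))) *
    (∫ t in Set.Ioi x, wK ((r-1)/2) α β t * φ t)

lemma SS_pos (r σ α β : ℝ) (φ : ℝ → ℝ) (S x : ℝ) (hr : 0 < r) (hα : 0 < α) (hb : (β/α)^2 < 1)
    (hs : σ^2 * (α^2 * (1 - (β/α)^2)) = 1) (hS : ∀ t, |φ t| ≤ S) (hx : 0 < x) :
    |x * SS r σ α β φ x| ≤
    (1 + 6/r + (if 2 ≤ r then √(π*(r-1)/2) * (1/(1-(β/α)^2))^(r/2-1) else 2)) * S := by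
  have hS0 : 0 ≤ S := (abs_nonneg _).trans (hS 0)
  refine le_trans ?_ (mul_le_mul_of_nonneg_right (scaled_bound r σ α β x hr hα hb hs hx) hS0)
  set ν := (r-1)/2 with hν
  have hK := besselK_nonneg ν (α*x)
  have hI := besselI_nonneg' ν (α*x) (by linarith) (by positivity)
  have h1 : |∫ t in (0:ℝ)..x, wI ν α β t * φ t| ≤ (∫ t in (0:ℝ)..x, wI ν α β t) * S := by
    rw [← intervalIntegral.integral_mul_const, ← Real.norm_eq_abs]
    refine intervalIntegral.norm_integral_le_of_norm_le hx.le (ae_of_all _ fun t ht => ?_)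
      ((wI_integrable r α β x hr hα hx).mul_const S)
    rw [Real.norm_eq_abs, abs_mul, abs_of_nonneg (wI_nonneg ν α β t (by linarith) hα ht.1)]
    exact mul_le_mul_of_nonneg_left (hS t) (wI_nonneg ν α β t (by linarith) hα ht.1)
  have h2 : |∫ t in Set.Ioi x, wK ν α β t * φ t| ≤ (∫ t in Set.Ioi x, wK ν α β t) * S := by
    rw [← integral_mul_const, ← Real.norm_eq_abs]
    refine norm_integral_le_of_norm_le (((wK_integrable ν α β (by linarith) hα hb).integrableOn).mul_const S)
      (ae_of_all _ fun t => ?_)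
    rw [Real.norm_eq_abs, abs_mul, abs_of_nonneg (wK_nonneg ν α β t)]
    exact mul_le_mul_of_nonneg_left (hS t) (wK_nonneg ν α β t)
  unfold SS
  rw [← hν, abs_of_pos hx]
  have hd : 0 ≤ Real.exp (-β*x) / (σ^2 * x^ν) := by positivity
  rw [abs_mul, abs_of_pos hx, mul_assoc]
  gcongr
  rw [← abs_neg]
  calc _ = |Real.exp (-β*x) / (σ^2 * x^ν) * (besselK ν (α*x) * (∫ t in (0:ℝ)..x, wI ν α β t * φ t) +
      besselI ν (α*x) * (∫ t in Set.Ioi x, wK ν α β t * φ t))| := by congr 1; ring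
    _ = Real.exp (-β*x) / (σ^2 * x^ν) * |besselK ν (α*x) * (∫ t in (0:ℝ)..x, wI ν α β t * φ t) +
      besselI ν (α*x) * (∫ t in Set.Ioi x, wK ν α β t * φ t)| := by rw [abs_mul, abs_of_nonneg hd]
    _ ≤ Real.exp (-β*x) / (σ^2 * x^ν) * (besselK ν (α*x) * ((∫ t in (0:ℝ)..x, wI ν α β t) * S) +
      besselI ν (α*x) * ((∫ t in Set.Ioi x, wK ν α β t) * S)) := by
        gcongr
        refine (abs_add_le _ _).trans ?_
        rw [abs_mul, abs_mul, abs_of_nonneg hK, abs_of_nonneg hI]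
        gcongr
    _ = _ := by ring

lemma SS_neg (r σ α β : ℝ) (φ : ℝ → ℝ) (x : ℝ) (hinteg : Integrable (fun t => wK ((r-1)/2) α β t * φ t))
    (h0 : ∫ t, wK ((r-1)/2) α β t * φ t = 0) :
    x * SS r σ α β φ x = (-x) * SS r σ α (-β) (fun t => φ (-t)) (-x) := by
  have hI : ∫ t in (0:ℝ)..x, wI ((r-1)/2) α β t * φ t = - ∫ t in (0:ℝ)..(-x), wI ((r-1)/2) α (-β) t * φ (-t) := by
    have := intervalIntegral.integral_comp_neg (a := 0) (b := -x) (fun t => wI ((r-1)/2) α β t * φ t)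
    rw [neg_neg, neg_zero, intervalIntegral.integral_symm 0 x] at this
    simp only [wI, abs_neg, neg_mul, mul_neg] at this ⊢
    linarith
  have hK : ∫ t in Set.Ioi x, wK ((r-1)/2) α β t * φ t = - ∫ t in Set.Ioi (-x), wK ((r-1)/2) α (-β) t * φ (-t) := by
    have := integral_comp_neg_Ioi (-x) (fun t => wK ((r-1)/2) α β t * φ t)
    rw [neg_neg] at this
    have h2 := intervalIntegral.integral_Iic_add_Ioi (b := x) hinteg.integrableOn hinteg.integrableOn
    rw [h0, ← this] at h2
    simp only [wK, abs_neg, neg_mul, mul_neg] at h2 ⊢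
    linarith
  unfold SS
  rw [hI, hK]
  simp only [abs_neg, neg_neg, neg_mul, mul_neg]
  ring

lemma vg_eq (r θ σ t : ℝ) (hσ : 0 < σ) : vgDensity r θ σ t =
    (σ * √π * Real.Gamma (r/2))⁻¹ * ((2 * √(θ^2+σ^2))^((r-1)/2))⁻¹ *
      wK ((r-1)/2) (√(θ^2+σ^2)/σ^2) (θ/σ^2) t := by
  unfold vgDensity wK
  rw [Real.div_rpow (abs_nonneg t) (by positivity), show θ*t/σ^2 = θ/σ^2*t by ring,
    show √(θ^2+σ^2)*|t|/σ^2 = √(θ^2+σ^2)/σ^2*|t| by ring]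
  field_simp

lemma ratio_eq (θ σ : ℝ) (hσ : 0 < σ) :
    1 - ((θ/σ^2)/(√(θ^2+σ^2)/σ^2))^2 = σ^2/(θ^2+σ^2) := by
  have hq : 0 < θ^2+σ^2 := by positivity
  rw [div_div_div_cancel_right₀ (by positivity), div_pow, Real.sq_sqrt hq.le]
  field_simp
  ring

lemma vg_integral (r θ σ : ℝ) (hr : 0 < r) (hσ : 0 < σ) : ∫ t, vgDensity r θ σ t = 1 := by
  have hq : 0 < θ^2+σ^2 := by positivity
  have hrat := ratio_eq θ σ hσ
  have hq2 : 0 < σ^2/(θ^2+σ^2) := by positivity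
  have hb : ((θ/σ^2)/(√(θ^2+σ^2)/σ^2))^2 < 1 := by linarith
  simp_rw [vg_eq r θ σ _ hσ]
  rw [integral_const_mul, wK_integral _ _ _ (by linarith) (by positivity) hb, hrat]
  have hG := Real.Gamma_pos_of_pos (by linarith : 0 < r/2)
  rw [show (r-1)/2+1/2 = r/2 by ring]
  set q := √(θ^2+σ^2) with hqd
  have hq0 : 0 < q := by positivity
  have hqq : θ^2+σ^2 = q^2 := (Real.sq_sqrt hq.le).symm
  rw [hqq, ← div_pow, ← Real.rpow_natCast (σ/q) 2, ← Real.rpow_mul (by positivity),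
    Real.mul_rpow (by norm_num) hq0.le, Real.div_rpow hq0.le (by positivity), ← Real.rpow_natCast σ 2,
    ← Real.rpow_mul hσ.le, Real.div_rpow hσ.le hq0.le]
  have e1 : ((2:ℕ):ℝ) * ((r-1)/2) = r - 1 := by push_cast; ring
  have e2 : ((2:ℕ):ℝ) * (r/2) = r := by push_cast; ring
  rw [e1, e2, show q^((r-1)/2) = q^((r-1)/2) from rfl]
  have e3 : q^r = q^((r-1)/2) * q^((r-1)/2) * q := by
    rw [← Real.rpow_add hq0]
    nth_rewrite 3 [← Real.rpow_one q]
    rw [← Real.rpow_add hq0]; congr 1; ring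
  have e4 : σ^r = σ^(r-1) * σ := by
    rw [Real.rpow_sub_one hσ.ne']; field_simp
  rw [e3, e4, Real.rpow_natCast]
  have p1 : 0 < q^((r-1)/2) := by positivity
  have p2 : 0 < σ^(r-1) := by positivity
  have p3 : (0:ℝ) < 2^((r-1)/2) := by positivity
  field_simp

lemma B_eq (r θ σ : ℝ) (hσ : 0 < σ) : Bconst r θ σ =
    if 2 ≤ r then √(π*(r-1)/2) * (1/(1-((θ/σ^2)/(√(θ^2+σ^2)/σ^2))^2))^(r/2-1) else 2 := by
  unfold Bconst
  have : 1 + θ^2/σ^2 = 1/(1-((θ/σ^2)/(√(θ^2+σ^2)/σ^2))^2) := by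
    rw [ratio_eq θ σ hσ]
    field_simp
    ring
  rw [this]

theorem stein_factor_xf_bounded (r θ σ : ℝ) (hr : 0 < r) (hσ : 0 < σ)
    (h : ℝ → ℝ) (hmeas : Measurable h) (M : ℝ) (hbd : ∀ t, |h t| ≤ M) :
    ∀ x : ℝ, x ≠ 0 →
      |x * steinSolution r θ σ h x| ≤
        (1 + 6 / r + Bconst r θ σ) * ⨆ t : ℝ, |htilde r θ σ h t| := by
  intro x hx
  have hq : 0 < θ^2+σ^2 := by positivity
  have hrat := ratio_eq θ σ hσ
  have hq2 : 0 < σ^2/(θ^2+σ^2) := by positivity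
  have hB := B_eq r θ σ hσ
  have hpe := fun t => vg_eq r θ σ t hσ
  have hp1 := vg_integral r θ σ hr hσ
  have hSS : steinSolution r θ σ h x = SS r σ (√(θ^2+σ^2)/σ^2) (θ/σ^2) (htilde r θ σ h) x := rfl
  rw [hSS, hB]
  have hα : 0 < √(θ^2+σ^2)/σ^2 := by positivity
  have hs : σ^2 * ((√(θ^2+σ^2)/σ^2)^2 * (1 - ((θ/σ^2)/(√(θ^2+σ^2)/σ^2))^2)) = 1 := by
    rw [hrat, div_pow, Real.sq_sqrt hq.le]
    field_simp
  set α := √(θ^2+σ^2)/σ^2 with hαd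
  set β := θ/σ^2 with hβd
  have hb : (β/α)^2 < 1 := by linarith
  have hbdd : BddAbove (Set.range fun t => |htilde r θ σ h t|) := by
    refine ⟨M + |∫ t, h t * vgDensity r θ σ t|, ?_⟩
    rintro _ ⟨t, rfl⟩
    unfold htilde
    exact (abs_sub _ _).trans (add_le_add_left (hbd t) _)
  have hS : ∀ t, |htilde r θ σ h t| ≤ ⨆ t : ℝ, |htilde r θ σ h t| := fun t => le_ciSup hbdd t
  rcases lt_or_gt_of_ne hx with hneg | hpos
  · have hwi := wK_integrable ((r-1)/2) α β (by linarith) hα hb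
    have hmt : Measurable (htilde r θ σ h) := hmeas.sub_const _
    have hinteg : Integrable (fun t => wK ((r-1)/2) α β t * htilde r θ σ h t) :=
      hwi.mul_bdd (c := ⨆ t : ℝ, |htilde r θ σ h t|) hmt.aestronglyMeasurable (ae_of_all _ hS)
    have hinteg2 : Integrable (fun t => wK ((r-1)/2) α β t * h t) :=
      hwi.mul_bdd (c := M) hmeas.aestronglyMeasurable (ae_of_all _ hbd)
    have h0 : ∫ t, wK ((r-1)/2) α β t * htilde r θ σ h t = 0 := by
      simp_rw [htilde, mul_sub]
      rw [integral_sub hinteg2 (hwi.mul_const _), integral_mul_const]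
      simp_rw [hpe] at hp1 ⊢
      rw [integral_const_mul] at hp1
      set k := (σ * √π * Real.Gamma (r/2))⁻¹ * ((2 * √(θ^2+σ^2))^((r-1)/2))⁻¹
      have : ∫ t, h t * (k * wK ((r-1)/2) α β t) = k * ∫ t, wK ((r-1)/2) α β t * h t := by
        rw [← integral_const_mul]
        congr 1; ext t; ring
      rw [this]
      linear_combination (-(∫ t, wK ((r-1)/2) α β t * h t)) * hp1
    rw [SS_neg r σ α β _ x hinteg h0]
    have e : (-β/α)^2 = (β/α)^2 := by rw [neg_div, neg_sq]
    have := SS_pos r σ α (-β) (fun t => htilde r θ σ h (-t)) _ (-x) hr hα (by rw [e]; exact hb)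
      (by rw [e]; exact hs) (fun t => hS (-t)) (by linarith)
    rw [e] at this
    exact this
  · exact SS_pos r σ α β _ _ x hr hα hb hs hS hpos
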